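/- Let n ≥ 2, α > n, p = 2(n-1)/(n+α-2) and t = 2n/(n+α) (so 0 < p, t < 1). Then for all nonnegative measurable functions f ∈ L^p(∂ℝ^n_+) and g ∈ L^t(ℝ^n_+), one has ∫_{ℝ^n_+} ∫_{∂ℝ^n_+} g(x) f(y) |x−y|^{α−n} dy dx ≥ C_{e1}(n,α) ‖f‖_{L^p(∂ℝ^n_+)} ‖g‖_{L^t(ℝ^n_+)}, where C_{e1}(n,α) = (nω_n)^{−(n+α−2)/(2(n−1))} · ( ∫_{B^n} ( ∫_{∂B^n} |ξ−ζ|^{α−n} dζ )^{2n/(n−α)} dξ )^{(n−α)/(2n)}. -/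

import Mathlib

noncomputable section

open MeasureTheory Metric ENNReal

/-- `ℝ^n` with the Euclidean norm. -/
abbrev Eu (n : ℕ) : Type := EuclideanSpace ℝ (Fin n)

/-- The last coordinate `x_n` of a point `x ∈ ℝ^n`. -/
def lastCoord (n : ℕ) (x : Eu n) : ℝ :=
  if h : 0 < n then x ⟨n - 1, Nat.sub_lt h Nat.one_pos⟩ else 0

/-- The first coordinate `x_1` of a point `x ∈ ℝ^n`. -/
def firstCoord (n : ℕ) (x : Eu n) : ℝ :=
  if h : 0 < n then x ⟨0, h⟩ else 0

/-- The open upper half space `ℝ^n_+ = {x : x_n > 0}`. -/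
def upperHalf (n : ℕ) : Set (Eu n) := {x | 0 < lastCoord n x}

/-- The identification of `ℝ^{n-1}` with the boundary `∂ℝ^n_+ = {x : x_n = 0}`. -/
def emb (n : ℕ) (y : Eu (n - 1)) : Eu n :=
  (EuclideanSpace.equiv (Fin n) ℝ).symm fun i =>
    if h : (i : ℕ) < n - 1 then y ⟨i, h⟩ else 0

/-- The point `z^o = (0,…,0,-1) ∈ ℝ^n`. -/
def zo (n : ℕ) : Eu n :=
  (EuclideanSpace.equiv (Fin n) ℝ).symm fun i => if (i : ℕ) = n - 1 then -1 else 0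

/-- The point `x^o = (0,…,0,-2) ∈ ℝ^n`. -/
def xo (n : ℕ) : Eu n :=
  (EuclideanSpace.equiv (Fin n) ℝ).symm fun i => if (i : ℕ) = n - 1 then -2 else 0

/-- The surface measure on the sphere `∂B^n = {x : |x - z^o| = 1}`. -/
def surf (n : ℕ) : Measure (Eu n) :=
  Measure.map (fun p : sphere (0 : Eu n) 1 => zo n + (p : Eu n))
    (volume : Measure (Eu n)).toSphere

/-- Lebesgue measure restricted to the open unit ball `B^n` centered at `z^o`. -/
def ballM (n : ℕ) : Measure (Eu n) := (volume : Measure (Eu n)).restrict (ball (zo n) 1)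

/-- `ω_n`, the volume of the unit ball in `ℝ^n`. -/
def unitBallVol (n : ℕ) : ℝ := ((volume : Measure (Eu n)) (ball (0 : Eu n) 1)).toReal

/-- `(∫ F^r)^{1/r}` (in `ℝ≥0∞`) of a nonnegative function `F`, for an arbitrary
nonzero real exponent `r`. -/
def eLp {X : Type*} [MeasurableSpace X] (μ : Measure X) (f : X → ℝ) (r : ℝ) : ℝ≥0∞ :=
  (∫⁻ x, ENNReal.ofReal (f x) ^ r ∂μ) ^ (1 / r)

/-- `(∫ F^r)^{1/r}` (in `ℝ≥0∞`) of an `ℝ≥0∞`-valued function `F`. -/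
def eLpE {X : Type*} [MeasurableSpace X] (μ : Measure X) (F : X → ℝ≥0∞) (r : ℝ) : ℝ≥0∞ :=
  (∫⁻ x, F x ^ r ∂μ) ^ (1 / r)

/-- The real `L^r`-norm `(∫ |f|^r)^{1/r}`. -/
def rLp {X : Type*} [MeasurableSpace X] (μ : Measure X) (f : X → ℝ) (r : ℝ) : ℝ :=
  (∫ x, |f x| ^ r ∂μ) ^ (1 / r)

/-- The sharp constant `C_{e1}(n,α)`. -/
def Ce1 (n : ℕ) (α : ℝ) : ℝ :=
  ((n : ℝ) * unitBallVol n) ^ (-(((n : ℝ) + α - 2) / (2 * ((n : ℝ) - 1)))) *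
    (∫ ξ in ball (zo n) 1,
        (∫ ζ, ‖ξ - ζ‖ ^ (α - (n : ℝ)) ∂surf n) ^ (2 * (n : ℝ) / ((n : ℝ) - α))) ^
      (((n : ℝ) - α) / (2 * (n : ℝ)))

/-- The sharp constant `C_{e2}(n,α)`. -/
def Ce2 (n : ℕ) (α : ℝ) : ℝ :=
  ((n : ℝ) * unitBallVol n) ^ (-(((n : ℝ) + α - 4) / (2 * ((n : ℝ) - 1)))) *
    (∫ ξ in ball (zo n) 1,
        (∫ ζ, (1 - ‖ξ - zo n‖ ^ 2) * ‖ξ - ζ‖ ^ (-((n : ℝ) - α + 2)) ∂surf n) ^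
          (2 * (n : ℝ) / ((n : ℝ) - α))) ^ (((n : ℝ) - α) / (2 * (n : ℝ)))


section

/-- measurable functions with values in `[c, C]` -/
def Band {Y : Type} [MeasurableSpace Y] (c C : ℝ) (φ : Y → ℝ) : Prop :=
  Measurable φ ∧ ∀ y, c ≤ φ y ∧ φ y ≤ C

def BddM {Y : Type} [MeasurableSpace Y] (v : Y → ℝ) : Prop :=
  Measurable v ∧ ∃ M : ℝ, ∀ y, |v y| ≤ M

lemma BddM.integrable {Y : Type} [MeasurableSpace Y] {μ : Measure Y} [IsFiniteMeasure μ]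
    {v : Y → ℝ} (h : BddM v) : Integrable v μ := by
  obtain ⟨M, hM⟩ := h.2
  exact Integrable.of_bound h.1.aestronglyMeasurable M (ae_of_all _ (by simpa using hM))

lemma BddM.mul {Y : Type} [MeasurableSpace Y] {v w : Y → ℝ} (hv : BddM v) (hw : BddM w) :
    BddM (fun y => v y * w y) := by
  obtain ⟨M, hM⟩ := hv.2
  obtain ⟨N, hN⟩ := hw.2
  refine ⟨hv.1.mul hw.1, M * N, fun y => ?_⟩
  rw [abs_mul]
  exact mul_le_mul (hM y) (hN y) (abs_nonneg _) ((abs_nonneg _).trans (hM y))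

lemma BddM.add {Y : Type} [MeasurableSpace Y] {v w : Y → ℝ} (hv : BddM v) (hw : BddM w) :
    BddM (fun y => v y + w y) := by
  obtain ⟨M, hM⟩ := hv.2
  obtain ⟨N, hN⟩ := hw.2
  exact ⟨hv.1.add hw.1, M + N, fun y => (abs_add_le _ _).trans (add_le_add (hM y) (hN y))⟩

lemma BddM.const {Y : Type} [MeasurableSpace Y] (c : ℝ) : BddM (fun _ : Y => c) :=
  ⟨measurable_const, |c|, fun _ => le_rfl⟩

lemma Band.bddM {Y : Type} [MeasurableSpace Y] {c C : ℝ} {φ : Y → ℝ} (h : Band c C φ) :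
    BddM φ := ⟨h.1, max |c| |C|, fun y => abs_le_max_abs_abs (h.2 y).1 (h.2 y).2⟩

lemma BddM.memLp {Y : Type} [MeasurableSpace Y] {μ : Measure Y} [IsFiniteMeasure μ]
    {v : Y → ℝ} (h : BddM v) : MemLp v 2 μ := by
  obtain ⟨M, hM⟩ := h.2
  exact MemLp.of_bound h.1.aestronglyMeasurable M (ae_of_all _ (by simpa using hM))

lemma Band.rpow {Y : Type} [MeasurableSpace Y] {c C r : ℝ} (hc : 0 < c) {φ : Y → ℝ}
    (h : Band c C φ) : BddM (fun y => φ y ^ r) := by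
  refine ⟨h.1.pow_const r, max (c ^ r) (C ^ r), fun y => ?_⟩
  have hy := h.2 y
  have h0 : 0 < φ y := hc.trans_le hy.1
  rw [abs_of_pos (Real.rpow_pos_of_pos h0 r)]
  rcases le_total 0 r with hr | hr
  · exact le_max_of_le_right (Real.rpow_le_rpow h0.le hy.2 hr)
  · exact le_max_of_le_left (Real.rpow_le_rpow_of_nonpos hc hy.1 hr)

theorem weak_compact {Y : Type} [MeasurableSpace Y] (μ : Measure Y) [IsFiniteMeasure μ]
    (c C : ℝ) (hcC : c ≤ C) :
    ∃ (T : Type) (_ : TopologicalSpace T) (_ : CompactSpace T) (rep : T → Y → ℝ),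
      (∀ τ, Band c C (rep τ)) ∧
      (∀ v, BddM v → Continuous fun τ => ∫ y, rep τ y * v y ∂μ) ∧
      (∀ φ, Band c C φ → ∃ τ, rep τ =ᵐ[μ] φ) := by
  let E := Lp ℝ 2 μ
  let one (s : Set Y) (hs : MeasurableSet s) : E := indicatorConstLp 2 hs (measure_ne_top μ s) 1
  let S : Set (WeakDual ℝ E) :=
    {Φ | ∀ s (hs : MeasurableSet s), c * μ.real s ≤ Φ (one s hs) ∧ Φ (one s hs) ≤ C * μ.real s}
  let R : WeakDual ℝ E → E := fun Φ => (InnerProductSpace.toDual ℝ E).symm (WeakDual.toStrongDual Φ)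
  have hR : ∀ Φ v, inner ℝ (R Φ) v = Φ v := fun Φ v => InnerProductSpace.toDual_symm_apply
  have hInt0 : ∀ Φ s (hs : MeasurableSet s), Φ (one s hs) = ∫ x in s, R Φ x ∂μ := by
    intro Φ s hs
    rw [← hR, real_inner_comm]
    exact L2.inner_indicatorConstLp_one hs _ _
  have hInt : ∀ Φ, Integrable (R Φ) μ := fun Φ =>
    (Lp.memLp (R Φ)).integrable (by norm_num)
  have hband : ∀ Φ ∈ S, ∀ᵐ y ∂μ, c ≤ R Φ y ∧ R Φ y ≤ C := by
    intro Φ hΦ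
    have h1 : (fun _ => c) ≤ᵐ[μ] R Φ := by
      refine ae_le_of_forall_setIntegral_le (integrable_const c) (hInt Φ) fun s hs _ => ?_
      rw [← hInt0 Φ s hs]
      simpa [mul_comm] using (hΦ s hs).1
    have h2 : R Φ ≤ᵐ[μ] (fun _ => C) := by
      refine ae_le_of_forall_setIntegral_le (hInt Φ) (integrable_const C) fun s hs _ => ?_
      rw [← hInt0 Φ s hs]
      simpa [mul_comm] using (hΦ s hs).2
    filter_upwards [h1, h2] with y a b using ⟨a, b⟩
  have hclosed : IsClosed S := by
    have : S = ⋂ (s : Set Y) (hs : MeasurableSet s),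
        {Φ : WeakDual ℝ E | c * μ.real s ≤ Φ (one s hs) ∧ Φ (one s hs) ≤ C * μ.real s} := by
      ext Φ; simp [S]
    rw [this]
    refine isClosed_iInter fun s => isClosed_iInter fun hs => ?_
    exact (isClosed_le continuous_const (WeakDual.eval_continuous _)).inter
      (isClosed_le (WeakDual.eval_continuous _) continuous_const)
  have hcomp : IsCompact S := by
    refine (WeakDual.isCompact_closedBall (0 : StrongDual ℝ E)
      ((measureUnivNNReal μ : ℝ) ^ (2 : ℝ≥0∞).toReal⁻¹ * max |c| |C|)).of_isClosed_subset hclosed ?_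
    intro Φ hΦ
    have h1 : ‖R Φ‖ ≤ (measureUnivNNReal μ : ℝ) ^ (2 : ℝ≥0∞).toReal⁻¹ * max |c| |C| := by
      refine Lp.norm_le_of_ae_bound (le_max_of_le_left (abs_nonneg _)) ?_
      filter_upwards [hband Φ hΦ] with y hy using abs_le_max_abs_abs hy.1 hy.2
    have h2 : ‖R Φ‖ = ‖WeakDual.toStrongDual Φ‖ := LinearIsometryEquiv.norm_map _ _
    simp only [Set.mem_preimage, mem_closedBall, dist_zero_right]
    rw [← h2]; exact h1
  have hrep : ∀ Φ : S, (fun y => max c (min C (R Φ y))) =ᵐ[μ] R Φ := by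
    intro Φ
    filter_upwards [hband Φ Φ.2] with y hy
    rw [min_eq_right hy.2, max_eq_right hy.1]
  refine ⟨S, inferInstance, isCompact_iff_compactSpace.1 hcomp,
    fun Φ y => max c (min C (R Φ y)), fun Φ => ⟨?_, fun y => ⟨le_max_left _ _, ?_⟩⟩, ?_, ?_⟩
  · exact measurable_const.max (measurable_const.min (Lp.stronglyMeasurable _).measurable)
  · exact max_le hcC (min_le_left _ _)
  · intro v hv
    have : (fun Φ : S => ∫ y, max c (min C (R Φ y)) * v y ∂μ)
        = fun Φ : S => (Φ : WeakDual ℝ E) (hv.memLp.toLp v) := by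
      ext Φ
      rw [← hR, L2.inner_def]
      refine integral_congr_ae ?_
      filter_upwards [hrep Φ, hv.memLp.coeFn_toLp (μ := μ)] with y h1 h2
      rw [h1, h2]; simp [mul_comm]
    rw [this]
    exact (WeakDual.eval_continuous _).comp continuous_subtype_val
  · intro φ hφ
    let e : E := hφ.bddM.memLp.toLp φ
    let Φ : WeakDual ℝ E := StrongDual.toWeakDual (InnerProductSpace.toDual ℝ E e)
    have hRΦ : R Φ = e := by simp [R, Φ]
    have he : e =ᵐ[μ] φ := hφ.bddM.memLp.coeFn_toLp
    have hS : Φ ∈ S := by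
      intro s hs
      rw [hInt0, hRΦ]
      have : ∫ x in s, e x ∂μ = ∫ x in s, φ x ∂μ := integral_congr_ae (ae_restrict_of_ae he)
      rw [this]
      have hi : IntegrableOn φ s μ := hφ.bddM.integrable.integrableOn
      constructor
      · have := setIntegral_mono (μ := μ) (s := s) (f := fun _ => c) (integrable_const c).integrableOn hi
          (fun y => (hφ.2 y).1)
        simpa [mul_comm] using this
      · have := setIntegral_mono (μ := μ) (s := s) (g := fun _ => C) hi (integrable_const C).integrableOn
          (fun y => (hφ.2 y).2)
        simpa [mul_comm] using this
    refine ⟨⟨Φ, hS⟩, (hrep ⟨Φ, hS⟩).trans ?_⟩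
    simp only
    rw [hRΦ]; exact he

end

section

/-- finite rank kernels -/
inductive FR {X Y : Type} [MeasurableSpace X] [MeasurableSpace Y] : (X → Y → ℝ) → Prop
  | prod (A : X → ℝ) (B : Y → ℝ) (hA : BddM A) (hB : BddM B) : FR (fun x y => A x * B y)
  | add (k l : X → Y → ℝ) (hk : FR k) (hl : FR l) : FR (fun x y => k x y + l x y)

section
variable {X Y : Type} [MeasurableSpace X] [MeasurableSpace Y]

lemma FR.of_eq {k l : X → Y → ℝ} (h : FR k) (e : ∀ x y, k x y = l x y) : FR l := by
  have : k = l := by funext x y; exact e x y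
  exact this ▸ h

lemma FR.bddM {k : X → Y → ℝ} (h : FR k) : BddM (fun z : X × Y => k z.1 z.2) := by
  induction h with
  | prod A B hA hB =>
    refine BddM.mul (v := fun z : X × Y => A z.1) (w := fun z : X × Y => B z.2) ?_ ?_
    · exact ⟨hA.1.comp measurable_fst, hA.2.imp fun _ h z => h z.1⟩
    · exact ⟨hB.1.comp measurable_snd, hB.2.imp fun _ h z => h z.2⟩
  | add k l _ _ ihk ihl => exact ihk.add ihl

lemma FR.mul_prod {k : X → Y → ℝ} (h : FR k) {A : X → ℝ} {B : Y → ℝ} (hA : BddM A) (hB : BddM B) :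
    FR (fun x y => k x y * (A x * B y)) := by
  induction h with
  | prod A' B' hA' hB' =>
    exact (FR.prod _ _ (hA'.mul hA) (hB'.mul hB)).of_eq fun x y => by ring
  | add k l _ _ ihk ihl =>
    exact (FR.add _ _ ihk ihl).of_eq fun x y => by ring

lemma FR.mul {k l : X → Y → ℝ} (hk : FR k) (hl : FR l) : FR (fun x y => k x y * l x y) := by
  induction hl with
  | prod A B hA hB => exact hk.mul_prod hA hB
  | add l l' _ _ h h' => exact (FR.add _ _ h h').of_eq fun x y => by ring

lemma FR.const (c : ℝ) : FR (fun (_ : X) (_ : Y) => c) :=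
  (FR.prod _ _ (BddM.const c) (BddM.const 1)).of_eq fun x y => by ring

lemma FR.sum {ι : Type} (s : Finset ι) {k : ι → X → Y → ℝ} (h : ∀ i, FR (k i)) :
    FR (fun x y => ∑ i ∈ s, k i x y) := by
  classical
  induction s using Finset.induction_on with
  | empty => simpa using FR.const 0
  | insert a s ha ih =>
    exact (FR.add _ _ (h a) ih).of_eq fun x y => by rw [Finset.sum_insert ha]

lemma FR.poly {k : X → Y → ℝ} (h : FR k) (P : Polynomial ℝ) : FR (fun x y => P.eval (k x y)) := by
  induction P using Polynomial.induction_on with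
  | C a => simpa using FR.const a
  | add P Q hP hQ => exact (FR.add _ _ hP hQ).of_eq fun x y => by simp
  | monomial m a ih => 
    exact (FR.mul ih h).of_eq fun x y => by simp [pow_succ, mul_assoc]

/-- uniformly approximable by finite rank kernels -/
def UFR (K : X → Y → ℝ) : Prop := ∀ δ > 0, ∃ k, FR k ∧ ∀ x y, |K x y - k x y| ≤ δ

/-- the powers of distances between bounded maps into a Euclidean space are approximable -/
lemma ufr_norm {n : ℕ} {a : X → Eu n} {b : Y → Eu n} (ha : Measurable a) (hb : Measurable b)
    {M : ℝ} (haM : ∀ x, ‖a x‖ ≤ M) (hbM : ∀ y, ‖b y‖ ≤ M) {l : ℝ} (hl : 0 < l) :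
    UFR (fun x y => ‖a x - b y‖ ^ l) := by
  have hsq : FR (fun x y => ‖a x - b y‖ ^ 2) := by
    have hcoord : ∀ (Z : Type) [MeasurableSpace Z] (a : Z → Eu n), Measurable a →
        (∀ x, ‖a x‖ ≤ M) → ∀ i, BddM (fun x => a x i) := by
      intro Z _ a ha haM i
      refine ⟨by fun_prop, M, fun x => ?_⟩
      exact (PiLp.norm_apply_le (a x) i).trans (haM x)
    have hnorm : ∀ (Z : Type) [MeasurableSpace Z] (a : Z → Eu n), Measurable a →
        (∀ x, ‖a x‖ ≤ M) → BddM (fun x => ‖a x‖ ^ 2) := by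
      intro Z _ a ha haM
      have h1 : BddM (fun x => ‖a x‖) := ⟨ha.norm, M, fun x => by simpa using haM x⟩
      simpa [sq] using h1.mul h1
    have h1 : FR (fun (x : X) (y : Y) => ‖a x‖ ^ 2 * 1) := FR.prod _ _ (hnorm X a ha haM) (BddM.const 1)
    have h2 : FR (fun (x : X) (y : Y) => 1 * ‖b y‖ ^ 2) := FR.prod _ _ (BddM.const 1) (hnorm Y b hb hbM)
    have h3 : FR (fun (x : X) (y : Y) => ∑ i, a x i * b y i) :=
      FR.sum Finset.univ fun i => FR.prod _ _ (hcoord X a ha haM i) (hcoord Y b hb hbM i)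
    refine (FR.add _ _ (FR.add _ _ h1 (FR.mul (FR.const (-2)) h3)) h2).of_eq fun x y => ?_
    rw [norm_sub_sq_real, PiLp.inner_apply]
    simp only [RCLike.inner_apply, conj_trivial, mul_comm]
    ring
  intro δ hδ
  obtain ⟨P, hP⟩ := exists_polynomial_near_of_continuousOn 0 ((2 * M) ^ 2) (fun s => s ^ (l / 2))
    (Real.continuous_rpow_const (by positivity)).continuousOn δ hδ
  refine ⟨_, hsq.poly P, fun x y => ?_⟩
  have h := hP (‖a x - b y‖ ^ 2) ⟨by positivity, ?_⟩
  · have e : (‖a x - b y‖ ^ 2) ^ (l / 2) = ‖a x - b y‖ ^ l := by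
      rw [← Real.rpow_natCast, ← Real.rpow_mul (norm_nonneg _)]
      congr 1; push_cast; ring
    rw [e] at h
    rw [abs_sub_comm]
    exact h.le
  · refine pow_le_pow_left₀ (norm_nonneg _) ((norm_sub_le _ _).trans ?_) 2
    linarith [haM x, hbM y]

variable (μ : Measure Y) (ν : Measure X)

/-- the bilinear functional -/
noncomputable def JJ (K : X → Y → ℝ) (φ : Y → ℝ) (ψ : X → ℝ) : ℝ :=
  ∫ z : X × Y, ψ z.1 * φ z.2 * K z.1 z.2 ∂(ν.prod μ)

variable [IsFiniteMeasure μ] [IsFiniteMeasure ν]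

lemma bddM_fst {ψ : X → ℝ} (h : BddM ψ) : BddM (fun z : X × Y => ψ z.1) :=
  ⟨h.1.comp measurable_fst, h.2.imp fun _ h z => h z.1⟩
lemma bddM_snd {ψ : Y → ℝ} (h : BddM ψ) : BddM (fun z : X × Y => ψ z.2) :=
  ⟨h.1.comp measurable_snd, h.2.imp fun _ h z => h z.2⟩

lemma JJ_cont_FR {T U : Type} [TopologicalSpace T] [TopologicalSpace U]
    {r : T → Y → ℝ} {s : U → X → ℝ} (hr : ∀ τ, BddM (r τ)) (hs : ∀ u, BddM (s u))
    (hr' : ∀ v, BddM v → Continuous fun τ => ∫ y, r τ y * v y ∂μ)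
    (hs' : ∀ v, BddM v → Continuous fun τ => ∫ y, s τ y * v y ∂ν)
    {k : X → Y → ℝ} (hk : FR k) : Continuous fun z : T × U => JJ μ ν k (r z.1) (s z.2) := by
  induction hk with
  | prod A B hA hB =>
    have : (fun z : T × U => JJ μ ν (fun x y => A x * B y) (r z.1) (s z.2)) =
        fun z : T × U => (∫ x, s z.2 x * A x ∂ν) * ∫ y, r z.1 y * B y ∂μ := by
      funext z
      rw [← integral_prod_mul, JJ]
      congr 1; funext w; ring
    rw [this]
    exact ((hs' A hA).comp continuous_snd).mul ((hr' B hB).comp continuous_fst)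
  | add k l hk hl ihk ihl =>
    have : (fun z : T × U => JJ μ ν (fun x y => k x y + l x y) (r z.1) (s z.2)) =
        fun z : T × U => JJ μ ν k (r z.1) (s z.2) + JJ μ ν l (r z.1) (s z.2) := by
      funext z
      have h0 := (bddM_fst (Y := Y) (hs z.2)).mul (bddM_snd (X := X) (hr z.1))
      rw [JJ, JJ, JJ, ← integral_add (h0.mul hk.bddM).integrable (h0.mul hl.bddM).integrable]
      congr 1; funext w; ring
    rw [this]
    exact ihk.add ihl

lemma JJ_cont {T U : Type} [TopologicalSpace T] [TopologicalSpace U] {c C : ℝ} (hc : 0 ≤ c)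
    {r : T → Y → ℝ} {s : U → X → ℝ} (hr : ∀ τ, Band c C (r τ)) (hs : ∀ u, Band c C (s u))
    (hr' : ∀ v, BddM v → Continuous fun τ => ∫ y, r τ y * v y ∂μ)
    (hs' : ∀ v, BddM v → Continuous fun τ => ∫ y, s τ y * v y ∂ν)
    {K : X → Y → ℝ} (hK : UFR K) (hKm : BddM fun z : X × Y => K z.1 z.2) :
    Continuous fun z : T × U => JJ μ ν K (r z.1) (s z.2) := by
  refine continuous_of_uniform_approx_of_continuous fun u hu => ?_
  obtain ⟨ε, hε, hεu⟩ := Metric.mem_uniformity_dist.1 hu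
  have hpos : 0 < C * C * (ν.prod μ).real Set.univ + 1 := by
    have := mul_self_nonneg C
    positivity
  obtain ⟨k, hk, hkK⟩ := hK (ε / 2 / (C * C * (ν.prod μ).real Set.univ + 1)) (by positivity)
  set δ := (ε / 2 / (C * C * (ν.prod μ).real Set.univ + 1)) with hδ
  have hδ0 : 0 < δ := by positivity
  refine ⟨_, JJ_cont_FR μ ν (fun τ => (hr τ).bddM) (fun τ => (hs τ).bddM) hr' hs' hk, fun z => ?_⟩
  apply hεu
  have h0 := (bddM_fst (Y := Y) (hs z.2).bddM).mul (bddM_snd (X := X) (hr z.1).bddM)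
  rw [Real.dist_eq, JJ, JJ, ← integral_sub (h0.mul hKm).integrable (h0.mul hk.bddM).integrable]
  have h1 : ‖∫ w : X × Y, (s z.2 w.1 * r z.1 w.2 * K w.1 w.2 - s z.2 w.1 * r z.1 w.2 * k w.1 w.2)
      ∂(ν.prod μ)‖ ≤ (C * C * δ) * (ν.prod μ).real Set.univ := by
    refine norm_integral_le_of_norm_le_const (ae_of_all _ fun w => ?_)
    rw [← mul_sub, Real.norm_eq_abs, abs_mul]
    have ha := (hs z.2).2 w.1
    have hb := (hr z.1).2 w.2
    rw [abs_of_nonneg (mul_nonneg (hc.trans ha.1) (hc.trans hb.1))]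
    exact mul_le_mul (mul_le_mul ha.2 hb.2 (hc.trans hb.1) (hc.trans (ha.1.trans ha.2)))
      (hkK _ _) (abs_nonneg _) (mul_self_nonneg C)
  rw [← Real.norm_eq_abs]
  refine h1.trans_lt ?_
  have : C * C * δ * (ν.prod μ).real Set.univ = (C * C * (ν.prod μ).real Set.univ) * δ := by ring
  have h2 : (C * C * (ν.prod μ).real Set.univ + 1) * δ = ε / 2 := by
    rw [hδ]; field_simp
  nlinarith
end

end

section

section
variable {X Y : Type} [MeasurableSpace X] [MeasurableSpace Y]

lemma rpow_tangent {a w r : ℝ} (ha : 0 < a) (hw : 0 < w) (h0 : 0 < r) (h1 : r < 1) :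
    a ^ r ≤ a * (r * w ^ (r - 1)) + (1 - r) * w ^ r := by
  have h := Real.geom_mean_le_arith_mean2_weighted h0.le (by linarith : 0 ≤ 1 - r) ha.le hw.le
    (by ring)
  have h2 : w ^ (r - 1) * w ^ (1 - r) = 1 := by
    rw [← Real.rpow_add hw]; simp
  have h3 : w ^ r = w ^ (r - 1) * w := by
    rw [← Real.rpow_add_one hw.ne']; ring_nf
  have h4 : 0 < w ^ (r - 1) := Real.rpow_pos_of_pos hw _
  calc a ^ r = w ^ (r - 1) * (a ^ r * w ^ (1 - r)) := by
        rw [mul_left_comm, h2, mul_one]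
    _ ≤ w ^ (r - 1) * (r * a + (1 - r) * w) := by gcongr
    _ = _ := by rw [h3]; ring

lemma rpow_usc {μ : Measure Y} [IsFiniteMeasure μ] {c C r : ℝ} (hc : 0 < c) (h0 : 0 < r) (h1 : r < 1)
    {φ w : Y → ℝ} (hφ : Band c C φ) (hw : Band c C w) :
    ∫ y, φ y ^ r ∂μ ≤ ∫ y, φ y * (r * w y ^ (r - 1)) ∂μ + ∫ y, (1 - r) * w y ^ r ∂μ := by
  have i1 : BddM fun y => φ y * (r * w y ^ (r - 1)) :=
    hφ.bddM.mul ((BddM.const r).mul (hw.rpow hc))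
  have i2 : BddM fun y => (1 - r) * w y ^ r := (BddM.const (1 - r)).mul (hw.rpow hc)
  rw [← integral_add i1.integrable i2.integrable]
  exact integral_mono (hφ.rpow hc).integrable (i1.add i2).integrable fun y =>
    rpow_tangent (hc.trans_le (hφ.2 y).1) (hc.trans_le (hw.2 y).1) h0 h1

lemma rpow_usc_eq {μ : Measure Y} [IsFiniteMeasure μ] {c C r : ℝ} (hc : 0 < c) 
    {w : Y → ℝ} (hw : Band c C w) :
    ∫ y, w y ^ r ∂μ = ∫ y, w y * (r * w y ^ (r - 1)) ∂μ + ∫ y, (1 - r) * w y ^ r ∂μ := by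
  have i1 : BddM fun y => w y * (r * w y ^ (r - 1)) :=
    hw.bddM.mul ((BddM.const r).mul (hw.rpow hc))
  have i2 : BddM fun y => (1 - r) * w y ^ r := (BddM.const (1 - r)).mul (hw.rpow hc)
  rw [← integral_add i1.integrable i2.integrable]
  congr 1; funext y
  have h0 := hc.trans_le (hw.2 y).1
  have h3 : w y ^ r = w y ^ (r - 1) * w y := by
    rw [← Real.rpow_add_one h0.ne']; ring_nf
  rw [h3]; ring

lemma rpow_int_pos {μ : Measure Y} [IsFiniteMeasure μ] [NeZero μ] {c C r : ℝ} (hc : 0 < c)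
    {w : Y → ℝ} (hw : Band c C w) : 0 < ∫ y, w y ^ r ∂μ := by
  rw [integral_pos_iff_support_of_nonneg (fun y => (Real.rpow_pos_of_pos (hc.trans_le (hw.2 y).1) _).le)
    (hw.rpow hc).integrable]
  have : (Function.support fun y => w y ^ r) = Set.univ := by
    ext y; simpa using (Real.rpow_pos_of_pos (hc.trans_le (hw.2 y).1) _).ne'
  rw [this]; exact Measure.measure_univ_pos.2 (NeZero.ne μ)

variable (μ : Measure Y) (ν : Measure X) 

noncomputable def Obj (K : X → Y → ℝ) (p t ε : ℝ) (φ : Y → ℝ) (ψ : X → ℝ) : ℝ :=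
  1 / p * Real.log (∫ y, φ y ^ p ∂μ) + 1 / t * Real.log (∫ x, ψ x ^ t ∂ν)
    - Real.log (JJ μ ν K φ ψ) + ε * ∫ y, φ y ^ (p / 2) ∂μ

variable [IsFiniteMeasure μ] [IsFiniteMeasure ν]

lemma JJ_congr {K : X → Y → ℝ} {φ φ' : Y → ℝ} {ψ ψ' : X → ℝ} (h : φ =ᵐ[μ] φ') (h' : ψ =ᵐ[ν] ψ') :
    JJ μ ν K φ ψ = JJ μ ν K φ' ψ' := by
  refine integral_congr_ae ?_
  have h1 := Measure.quasiMeasurePreserving_snd (μ := ν) (ν := μ) |>.ae h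
  have h2 := Measure.quasiMeasurePreserving_fst (μ := ν) (ν := μ) |>.ae h'
  filter_upwards [h1, h2] with z a b
  rw [a, b]

lemma Obj_congr {K : X → Y → ℝ} {p t ε : ℝ} {φ φ' : Y → ℝ} {ψ ψ' : X → ℝ}
    (h : φ =ᵐ[μ] φ') (h' : ψ =ᵐ[ν] ψ') :
    Obj μ ν K p t ε φ ψ = Obj μ ν K p t ε φ' ψ' := by
  have e1 : ∀ r : ℝ, ∫ y, φ y ^ r ∂μ = ∫ y, φ' y ^ r ∂μ := fun r =>
    integral_congr_ae (by filter_upwards [h] with y hy; rw [hy])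
  have e2 : ∀ r : ℝ, ∫ y, ψ y ^ r ∂ν = ∫ y, ψ' y ^ r ∂ν := fun r =>
    integral_congr_ae (by filter_upwards [h'] with y hy; rw [hy])
  rw [Obj, Obj, e1, e1, e2, JJ_congr μ ν h h']

lemma JJ_bdd {K : X → Y → ℝ} (hKm : BddM fun z : X × Y => K z.1 z.2) {φ : Y → ℝ} {ψ : X → ℝ}
    (hφ : BddM φ) (hψ : BddM ψ) : BddM fun z : X × Y => ψ z.1 * φ z.2 * K z.1 z.2 :=
  ((bddM_fst hψ).mul (bddM_snd hφ)).mul hKm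

lemma JJ_pos {K : X → Y → ℝ} (hKm : BddM fun z : X × Y => K z.1 z.2) (hK0 : ∀ x y, 0 ≤ K x y)
    (hK1 : 0 < JJ μ ν K 1 1) {c C : ℝ} (hc : 0 < c) {φ : Y → ℝ} {ψ : X → ℝ}
    (hφ : Band c C φ) (hψ : Band c C ψ) : 0 < JJ μ ν K φ ψ := by
  have h1 : c * c * JJ μ ν K 1 1 ≤ JJ μ ν K φ ψ := by
    rw [JJ, JJ, ← integral_const_mul]
    refine integral_mono ?_ (JJ_bdd hKm hφ.bddM hψ.bddM).integrable fun z => ?_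
    · simpa using (((BddM.const (c * c)).mul hKm).integrable)
    · simp only [Pi.one_apply, one_mul]
      have := (hφ.2 z.2).1
      have := (hψ.2 z.1).1
      have := hK0 z.1 z.2
      have h0 : 0 ≤ ψ z.1 := hc.le.trans (hψ.2 z.1).1
      have h1 : 0 ≤ φ z.2 := hc.le.trans (hφ.2 z.2).1
      gcongr
  exact lt_of_lt_of_le (by positivity) h1

lemma Obj_exists_max {K : X → Y → ℝ} (hK : UFR K) (hKm : BddM fun z : X × Y => K z.1 z.2)
    (hK0 : ∀ x y, 0 ≤ K x y) (hK1 : 0 < JJ μ ν K 1 1) [NeZero μ] [NeZero ν]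
    {c C p t ε : ℝ} (hc : 0 < c) (hcC : c ≤ C) (hp : 0 < p) (hp1 : p < 1) (ht : 0 < t) (ht1 : t < 1)
    (hε : 0 < ε) : ∃ φ₀ ψ₀, Band c C φ₀ ∧ Band c C ψ₀ ∧ ∀ φ ψ, Band c C φ → Band c C ψ →
      Obj μ ν K p t ε φ ψ ≤ Obj μ ν K p t ε φ₀ ψ₀ := by
  obtain ⟨T, _, _, r, hr, hr', hr''⟩ := weak_compact μ c C hcC
  obtain ⟨U, _, _, s, hs, hs', hs''⟩ := weak_compact ν c C hcC
  have hne : (Set.univ : Set (T × U)).Nonempty := by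
    obtain ⟨τ, -⟩ := hr'' (fun _ => c) ⟨measurable_const, fun _ => ⟨le_rfl, hcC⟩⟩
    obtain ⟨u, -⟩ := hs'' (fun _ => c) ⟨measurable_const, fun _ => ⟨le_rfl, hcC⟩⟩
    exact ⟨(τ, u), trivial⟩
  have husc : UpperSemicontinuousOn (fun z : T × U => Obj μ ν K p t ε (r z.1) (s z.2)) Set.univ := by
    intro z₀ _ a ha
    let L1 : ℝ → T → ℝ := fun q τ => ∫ y, r τ y * (q * r z₀.1 y ^ (q - 1)) ∂μ +
      ∫ y, (1 - q) * r z₀.1 y ^ q ∂μ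
    let L2 : U → ℝ := fun τ => ∫ y, s τ y * (t * s z₀.2 y ^ (t - 1)) ∂ν +
      ∫ y, (1 - t) * s z₀.2 y ^ t ∂ν
    have hL1 : ∀ q, Continuous (L1 q) := fun q =>
      (hr' _ ((BddM.const q).mul ((hr z₀.1).rpow hc))).add continuous_const
    have hL2 : Continuous L2 :=
      (hs' _ ((BddM.const t).mul ((hs z₀.2).rpow hc))).add continuous_const
    have e1 : ∀ q, ∫ y, r z₀.1 y ^ q ∂μ = L1 q z₀.1 := fun q => rpow_usc_eq hc (hr z₀.1)
    have e2 : ∫ y, s z₀.2 y ^ t ∂ν = L2 z₀.2 := rpow_usc_eq hc (hs z₀.2)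
    let g : T × U → ℝ := fun z => 1 / p * Real.log (L1 p z.1) + 1 / t * Real.log (L2 z.2)
      - Real.log (JJ μ ν K (r z.1) (s z.2)) + ε * L1 (p / 2) z.1
    have hg : ContinuousAt g z₀ := by
      have c1 : ContinuousAt (fun z : T × U => L1 p z.1) z₀ :=
        ((hL1 p).comp continuous_fst).continuousAt
      have c2 : ContinuousAt (fun z : T × U => L2 z.2) z₀ :=
        (hL2.comp continuous_snd).continuousAt
      have c3 : ContinuousAt (fun z : T × U => JJ μ ν K (r z.1) (s z.2)) z₀ :=
        (JJ_cont μ ν hc.le hr hs hr' hs' hK hKm).continuousAt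
      have c4 : ContinuousAt (fun z : T × U => L1 (p / 2) z.1) z₀ :=
        ((hL1 (p / 2)).comp continuous_fst).continuousAt
      have p1 : L1 p z₀.1 ≠ 0 := by rw [← e1]; exact (rpow_int_pos hc (hr _)).ne'
      have p2 : L2 z₀.2 ≠ 0 := by rw [← e2]; exact (rpow_int_pos hc (hs _)).ne'
      exact (((continuousAt_const.mul (c1.log p1)).add (continuousAt_const.mul (c2.log p2))).sub
        (c3.log (JJ_pos μ ν hKm hK0 hK1 hc (hr _) (hs _)).ne')).add (continuousAt_const.mul c4)
    have hg0 : g z₀ = Obj μ ν K p t ε (r z₀.1) (s z₀.2) := by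
      simp only [g, Obj, e1, e2]
    have hle : ∀ z, Obj μ ν K p t ε (r z.1) (s z.2) ≤ g z := by
      intro z
      simp only [g, Obj]
      have b1 : ∀ q, 0 < q → q < 1 → ∫ y, r z.1 y ^ q ∂μ ≤ L1 q z.1 := fun q h0 h1 =>
        rpow_usc hc h0 h1 (hr _) (hr _)
      have b2 : ∫ y, s z.2 y ^ t ∂ν ≤ L2 z.2 := rpow_usc hc ht ht1 (hs _) (hs _)
      have b3 := b1 (p / 2) (by linarith) (by linarith)
      have b1 := Real.log_le_log (rpow_int_pos hc (hr _)) (b1 p hp hp1)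
      have b2 := Real.log_le_log (rpow_int_pos hc (hs _)) b2
      gcongr
    have := hg.eventually_lt_const (u := a) (by rw [hg0]; exact ha)
    rw [nhdsWithin_univ]
    filter_upwards [this] with z hz using (hle z).trans_lt hz
  obtain ⟨z, -, hz⟩ := UpperSemicontinuousOn.exists_isMaxOn hne isCompact_univ husc
  refine ⟨r z.1, s z.2, hr _, hs _, fun φ ψ hφ hψ => ?_⟩
  obtain ⟨τ, hτ⟩ := hr'' φ hφ
  obtain ⟨u, hu⟩ := hs'' ψ hψ
  rw [← Obj_congr μ ν hτ hu]
  exact hz (Set.mem_univ (τ, u))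

theorem abs_opt {K : X → Y → ℝ} (hK : UFR K) (hKm : BddM fun z : X × Y => K z.1 z.2)
    (hK0 : ∀ x y, 0 ≤ K x y) (hK1 : 0 < JJ μ ν K 1 1) [NeZero μ] [NeZero ν]
    {c C p t κ : ℝ} (hc : 0 < c) (hcC : c ≤ C) (hp : 0 < p) (hp1 : p < 1) (ht : 0 < t) (ht1 : t < 1)
    (hImp : ∀ φ ψ, Band c C φ → Band c C ψ → (∃ s : ℝ, φ =ᵐ[μ] fun _ => s) ∨
      ∃ φ' ψ', Band c C φ' ∧ Band c C ψ' ∧ ∫ y, φ' y ^ p ∂μ = ∫ y, φ y ^ p ∂μ ∧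
        ∫ x, ψ' x ^ t ∂ν = ∫ x, ψ x ^ t ∂ν ∧ JJ μ ν K φ' ψ' ≤ JJ μ ν K φ ψ ∧
        ∫ y, φ y ^ (p / 2) ∂μ < ∫ y, φ' y ^ (p / 2) ∂μ)
    (hκ : 0 < κ) (hκ' : ∀ ψ, Band c C ψ →
      κ * (μ.real Set.univ) ^ (1 / p) * (∫ x, ψ x ^ t ∂ν) ^ (1 / t) ≤ JJ μ ν K 1 ψ)
    (φ : Y → ℝ) (ψ : X → ℝ) (hφ : Band c C φ) (hψ : Band c C ψ) :
    κ * (∫ y, φ y ^ p ∂μ) ^ (1 / p) * (∫ x, ψ x ^ t ∂ν) ^ (1 / t) ≤ JJ μ ν K φ ψ := by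
  have hC : 0 < C := hc.trans_le hcC
  have hμ : 0 < μ.real Set.univ := measureReal_univ_pos
  have key : ∀ ε > 0, Obj μ ν K p t ε φ ψ ≤ - Real.log κ + ε * (C ^ (p / 2) * μ.real Set.univ) := by
    intro ε hε
    obtain ⟨φ₀, ψ₀, h1, h2, hmax⟩ := Obj_exists_max μ ν hK hKm hK0 hK1 hc hcC hp hp1 ht ht1 hε
    refine (hmax φ ψ hφ hψ).trans ?_
    rcases hImp φ₀ ψ₀ h1 h2 with ⟨s, hs⟩ | ⟨φ', ψ', h1', h2', ep, et, hJ, hN⟩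
    · have hs0 : 0 < s ∧ s ≤ C := by
        have : ∀ᵐ y ∂μ, 0 < s ∧ s ≤ C := by
          filter_upwards [hs] with y hy
          rw [← hy]; exact ⟨hc.trans_le (h1.2 y).1, (h1.2 y).2⟩
        obtain ⟨y, hy⟩ := this.exists
        exact hy
      rw [Obj_congr μ ν hs (Filter.EventuallyEq.refl _ ψ₀), Obj]
      have hJ : JJ μ ν K (fun _ => s) ψ₀ = s * JJ μ ν K 1 ψ₀ := by
        rw [JJ, JJ, ← integral_const_mul]; congr 1; funext z; simp only [Pi.one_apply]; ring
      have hψ0 := rpow_int_pos (μ := ν) (r := t) hc h2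
      have hb := hκ' ψ₀ h2
      have hpos : 0 < κ * (μ.real Set.univ) ^ (1 / p) * (∫ x, ψ₀ x ^ t ∂ν) ^ (1 / t) := by positivity
      have hl := Real.log_le_log hpos hb
      rw [Real.log_mul (by positivity) (by positivity), Real.log_mul (by positivity) (by positivity),
        Real.log_rpow hμ, Real.log_rpow hψ0] at hl
      rw [hJ, Real.log_mul hs0.1.ne' (hpos.trans_le hb).ne']
      simp only [integral_const, smul_eq_mul]
      rw [Real.log_mul hμ.ne' (by have := hs0.1; positivity), Real.log_rpow hs0.1]
      have h5 : s ^ (p / 2) ≤ C ^ (p / 2) := Real.rpow_le_rpow hs0.1.le hs0.2 (by positivity)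
      have h6 : ε * (μ.real Set.univ * s ^ (p / 2)) ≤ ε * (C ^ (p / 2) * μ.real Set.univ) := by
        rw [mul_comm (C ^ (p / 2))]; gcongr
      have h7 : 1 / p * (Real.log (μ.real Set.univ) + p * Real.log s) =
        1 / p * Real.log (μ.real Set.univ) + Real.log s := by field_simp
      linarith
    · exfalso
      have := hmax φ' ψ' h1' h2'
      rw [Obj, Obj, ep, et] at this
      have hl := Real.log_le_log (JJ_pos μ ν hKm hK0 hK1 hc h1' h2') hJ
      have := mul_lt_mul_of_pos_left hN hε
      linarith
  have hA := rpow_int_pos (μ := μ) (r := p) hc hφ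
  have hB := rpow_int_pos (μ := ν) (r := t) hc hψ
  have hJ := JJ_pos μ ν hKm hK0 hK1 hc hφ hψ
  have hN : 0 ≤ ∫ y, φ y ^ (p / 2) ∂μ := (rpow_int_pos hc hφ).le
  have key2 : 1 / p * Real.log (∫ y, φ y ^ p ∂μ) + 1 / t * Real.log (∫ x, ψ x ^ t ∂ν)
    - Real.log (JJ μ ν K φ ψ) ≤ - Real.log κ := by
    refine le_of_forall_pos_le_add fun η hη => ?_
    have hM : 0 < C ^ (p / 2) * μ.real Set.univ := by positivity
    have := key (η / (C ^ (p / 2) * μ.real Set.univ)) (by positivity)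
    rw [div_mul_cancel₀ _ hM.ne', Obj] at this
    have : 0 ≤ η / (C ^ (p / 2) * μ.real Set.univ) * ∫ y, φ y ^ (p / 2) ∂μ := by positivity
    linarith
  rw [← Real.log_le_log_iff (by positivity) hJ, Real.log_mul (by positivity) (by positivity),
    Real.log_mul (by positivity) (by positivity), Real.log_rpow hA, Real.log_rpow hB]
  linarith
end

end

section

/-- abstract two-fold symmetry of a measure space -/
structure Fold {Y : Type} [MeasurableSpace Y] (μ : Measure Y) (D : ℝ) (τ : Y → Y) (m : Y → ℝ)
    (H : Set Y) : Prop where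
  hτ : Measurable τ
  hm : Measurable m
  hH : MeasurableSet H
  inv : ∀ y ∈ H, τ (τ y) = y
  nmem : ∀ y ∈ H, τ y ∉ H
  pos : ∀ y ∈ H, 0 < m y
  lt : ∀ y ∈ H, m y < 1
  fold : ∀ G : Y → ℝ≥0∞, Measurable G →
    ∫⁻ y, G y ∂μ = ∫⁻ y in H, (G y + ENNReal.ofReal (m y ^ D) * G (τ y)) ∂μ

section
open Classical in
/-- polarization -/
noncomputable def Pol {Y : Type} (τ : Y → Y) (m : Y → ℝ) (H : Set Y) (e : ℝ) (φ : Y → ℝ) (y : Y) : ℝ :=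
  if y ∈ H then max (φ y) (m y ^ e * φ (τ y)) else
    if τ y ∈ H then min (φ y) (m (τ y) ^ (-e) * φ (τ y)) else φ y
end

section
variable {X Y : Type} [MeasurableSpace X] [MeasurableSpace Y]
variable {μ : Measure Y} {D : ℝ} {τ : Y → Y} {m : Y → ℝ} {H : Set Y}

lemma Pol_mem {e : ℝ} {φ : Y → ℝ} {y : Y} (hy : y ∈ H) :
    Pol τ m H e φ y = max (φ y) (m y ^ e * φ (τ y)) := by
  simp [Pol, hy]

lemma Pol_tau (h : Fold μ D τ m H) {e : ℝ} {φ : Y → ℝ} {y : Y} (hy : y ∈ H) :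
    m y ^ e * Pol τ m H e φ (τ y) = min (φ y) (m y ^ e * φ (τ y)) := by
  have h1 := h.nmem y hy
  have h2 := h.inv y hy
  have h3 := h.pos y hy
  simp only [Pol, h1, h2, hy, if_true, if_false]
  rw [mul_min_of_nonneg _ _ (by positivity), ← mul_assoc, ← Real.rpow_add h3]
  simp [min_comm]

lemma Pol_band (h : Fold μ D τ m H) {e c C : ℝ} (hc : 0 < c) (he : 0 < e) {φ : Y → ℝ}
    (hφ : Band c C φ) : Band c C (Pol τ m H e φ) := by
  have := hφ.1
  have h1 := h.hτ
  have h2 := h.hm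
  refine ⟨?_, fun y => ?_⟩
  · unfold Pol
    refine Measurable.ite h.hH (by fun_prop) (Measurable.ite (h1 h.hH) (by fun_prop) (by fun_prop))
  · have b1 := hφ.2 y
    have b2 := hφ.2 (τ y)
    unfold Pol
    split_ifs with g1 g2
    · refine ⟨le_max_of_le_left b1.1, max_le b1.2 ?_⟩
      have : m y ^ e ≤ 1 := Real.rpow_le_one (h.pos y g1).le (h.lt y g1).le he.le
      nlinarith
    · refine ⟨le_min b1.1 ?_, min_le_of_left_le b1.2⟩
      have : 1 ≤ m (τ y) ^ (-e) := Real.one_le_rpow_of_pos_of_le_one_of_nonpos (h.pos _ g2) (h.lt _ g2).le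
        (by linarith)
      nlinarith
    · exact b1

lemma Fold.real (h : Fold μ D τ m H) {G : Y → ℝ} (hG : Measurable G) (h0 : ∀ y, 0 ≤ G y) :
    ∫ y, G y ∂μ = ∫ y in H, (G y + m y ^ D * G (τ y)) ∂μ := by
  have h1 := h.hτ
  have h2 := h.hm
  rw [integral_eq_lintegral_of_nonneg_ae (ae_of_all _ h0) hG.aestronglyMeasurable, h.fold _ (by fun_prop)]
  have hp : ∀ᵐ y ∂(μ.restrict H), 0 ≤ G y + m y ^ D * G (τ y) := by
    filter_upwards [ae_restrict_mem h.hH] with y hy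
    have := h.pos y hy
    have := h0 y
    have := h0 (τ y)
    positivity
  rw [integral_eq_lintegral_of_nonneg_ae hp (by fun_prop)]
  congr 1
  refine lintegral_congr_ae ?_
  filter_upwards [ae_restrict_mem h.hH] with y hy
  have := h.pos y hy
  have := h0 y
  have := h0 (τ y)
  rw [ENNReal.ofReal_add (by positivity) (by positivity), ENNReal.ofReal_mul (by positivity)]

lemma max_min_rpow (a b r : ℝ) : max a b ^ r + min a b ^ r = a ^ r + b ^ r := by
  rcases le_total a b with h | h <;> simp [h, add_comm]

lemma Pol_pow (h : Fold μ D τ m H) {e c C q : ℝ} (hc : 0 < c) (he : 0 < e) {φ : Y → ℝ}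
    (hφ : Band c C φ) (hq : q * e = D) :
    ∫ y, Pol τ m H e φ y ^ q ∂μ = ∫ y, φ y ^ q ∂μ := by
  have hP := Pol_band h hc he hφ
  rw [h.real (hP.1.pow_const _) fun y => (Real.rpow_nonneg (hc.le.trans (hP.2 y).1) _),
    h.real (hφ.1.pow_const _) fun y => (Real.rpow_nonneg (hc.le.trans (hφ.2 y).1) _)]
  refine setIntegral_congr_fun h.hH fun y hy => ?_
  have hm := h.pos y hy
  have e1 : m y ^ D = (m y ^ e) ^ q := by rw [← Real.rpow_mul hm.le, mul_comm, hq]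
  rw [e1, ← Real.mul_rpow (by positivity) (hc.le.trans (hP.2 _).1), Pol_tau h hy, Pol_mem hy,
    ← Real.mul_rpow (by positivity) (hc.le.trans (hφ.2 _).1), max_min_rpow]

lemma Fold.integrable (h : Fold μ D τ m H) [IsFiniteMeasure μ] (hD : 0 < D) {G : Y → ℝ} (hG : BddM G) :
    IntegrableOn (fun y => G y + m y ^ D * G (τ y)) H μ := by
  have h1 := h.hτ
  have h2 := h.hm
  have h3 := hG.1
  obtain ⟨M, hM⟩ := hG.2
  refine IntegrableOn.congr_fun (f := fun y => G y + H.indicator (fun y => m y ^ D) y * G (τ y)) ?_ ?_ h.hH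
  · refine Integrable.integrableOn (BddM.integrable (hG.add (BddM.mul ?_ ?_)))
    · refine ⟨(by fun_prop : Measurable fun y => m y ^ D).indicator h.hH, 1, fun y => ?_⟩
      by_cases hy : y ∈ H
      · have := h.pos y hy
        simp only [hy, Set.indicator_of_mem]
        rw [abs_of_nonneg (by positivity)]
        exact Real.rpow_le_one this.le (h.lt y hy).le hD.le
      · simp [hy]
    · exact ⟨h3.comp h1, M, fun y => hM _⟩
  · intro y hy
    simp [hy]

lemma Pol_strict (h : Fold μ D τ m H) [IsFiniteMeasure μ] (hD : 0 < D)
    {e c C q : ℝ} (hc : 0 < c) (he : 0 < e) {φ : Y → ℝ}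
    (hφ : Band c C φ) (hq : q * e = D / 2) (hq0 : 0 < q) :
    (∀ᵐ y ∂μ, y ∈ H → m y ^ e * φ (τ y) ≤ φ y) ∨
    ∫ y, φ y ^ q ∂μ < ∫ y, Pol τ m H e φ y ^ q ∂μ := by
  have hP := Pol_band h hc he hφ
  rw [h.real (hP.1.pow_const _) fun y => (Real.rpow_nonneg (hc.le.trans (hP.2 y).1) _),
    h.real (hφ.1.pow_const _) fun y => (Real.rpow_nonneg (hc.le.trans (hφ.2 y).1) _)]
  have key : ∀ y ∈ H, Pol τ m H e φ y ^ q + m y ^ D * Pol τ m H e φ (τ y) ^ q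
      - (φ y ^ q + m y ^ D * φ (τ y) ^ q) =
      (1 - m y ^ (D / 2)) * (max (φ y) (m y ^ e * φ (τ y)) ^ q - φ y ^ q) := by
    intro y hy
    have hm := h.pos y hy
    have e1 : m y ^ D = m y ^ (D/2) * (m y ^ e) ^ q := by
      rw [← Real.rpow_mul hm.le, ← Real.rpow_add hm, mul_comm e, hq]; congr 1; ring
    rw [e1, mul_assoc, mul_assoc, ← Real.mul_rpow (by positivity) (hc.le.trans (hP.2 _).1),
      Pol_tau h hy, Pol_mem hy,
      ← Real.mul_rpow (by positivity) (hc.le.trans (hφ.2 _).1)]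
    linear_combination (m y ^ (D/2)) * max_min_rpow (φ y) (m y ^ e * φ (τ y)) q
  have hm1 : ∀ y ∈ H, m y ^ (D / 2) < 1 := fun y hy =>
    Real.rpow_lt_one (h.pos y hy).le (h.lt y hy) (by linarith)
  have hle : ∀ᵐ y ∂(μ.restrict H), φ y ^ q + m y ^ D * φ (τ y) ^ q ≤
      Pol τ m H e φ y ^ q + m y ^ D * Pol τ m H e φ (τ y) ^ q := by
    filter_upwards [ae_restrict_mem h.hH] with y hy
    rw [← sub_nonneg, key y hy]
    have := hm1 y hy
    have h3 : φ y ^ q ≤ max (φ y) (m y ^ e * φ (τ y)) ^ q :=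
      Real.rpow_le_rpow (hc.le.trans (hφ.2 _).1) (le_max_left _ _) hq0.le
    exact mul_nonneg (by linarith) (by linarith)
  have i1 := h.integrable hD (hφ.rpow (r := q) hc)
  have i2 := h.integrable hD (hP.rpow (r := q) hc)
  rcases (integral_mono_ae i1 i2 hle).lt_or_eq with h4 | h4
  · exact Or.inr h4
  · left
    have h5 := (integral_eq_iff_of_ae_le i1 i2 hle).1 h4
    rw [← ae_restrict_iff' h.hH]
    filter_upwards [ae_restrict_mem h.hH, h5] with y hy h5
    have h6 := key y hy
    rw [← h5, sub_self] at h6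
    rcases mul_eq_zero.1 h6.symm with h7 | h7
    · linarith [hm1 y hy]
    · by_contra hlt
      push Not at hlt
      rw [max_eq_right hlt.le] at h7
      have := Real.rpow_lt_rpow (hc.le.trans (hφ.2 y).1) hlt hq0
      linarith

lemma rearr {A B C D K L : ℝ} (hKL : K ≤ L) :
    (max A B * max C D + min A B * min C D) * K + (max A B * min C D + min A B * max C D) * L ≤
    (A * C + B * D) * K + (A * D + B * C) * L := by
  rcases le_total A B with h | h <;> rcases le_total C D with h' | h' <;> simp only [h, h', max_eq_left,
    max_eq_right, min_eq_left, min_eq_right]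
  · nlinarith
  · nlinarith [mul_nonneg (mul_nonneg (sub_nonneg.2 h) (sub_nonneg.2 h')) (sub_nonneg.2 hKL)]
  · nlinarith [mul_nonneg (mul_nonneg (sub_nonneg.2 h) (sub_nonneg.2 h')) (sub_nonneg.2 hKL)]
  · nlinarith

variable {ν : Measure X} {D' : ℝ} {τ' : X → X} {m' : X → ℝ} {H' : Set X}

noncomputable def FF (K : X → Y → ℝ) (D D' : ℝ) (τ : Y → Y) (m : Y → ℝ) (τ' : X → X) (m' : X → ℝ)
    (φ : Y → ℝ) (ψ : X → ℝ) (x : X) (y : Y) : ℝ :=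
  ψ x * φ y * K x y + m y ^ D * (ψ x * φ (τ y) * K x (τ y)) +
  m' x ^ D' * (ψ (τ' x) * φ y * K (τ' x) y + m y ^ D * (ψ (τ' x) * φ (τ y) * K (τ' x) (τ y)))

lemma JJ_fold [IsFiniteMeasure μ] [IsFiniteMeasure ν] (h : Fold μ D τ m H) (h' : Fold ν D' τ' m' H')
    {K : X → Y → ℝ} (hKm : BddM fun z : X × Y => K z.1 z.2) (hK0 : ∀ x y, 0 ≤ K x y)
    {φ : Y → ℝ} {ψ : X → ℝ} (hφ : BddM φ) (hψ : BddM ψ) (h0 : ∀ y, 0 ≤ φ y) (h0' : ∀ x, 0 ≤ ψ x) :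
    ENNReal.ofReal (JJ μ ν K φ ψ) =
      ∫⁻ x in H', ∫⁻ y in H, ENNReal.ofReal (FF K D D' τ m τ' m' φ ψ x y) ∂μ ∂ν := by
  have h1 := h.hτ
  have h2 := h.hm
  have h1' := h'.hτ
  have h2' := h'.hm
  have hφm := hφ.1
  have hψm := hψ.1
  have hKm1 := hKm.1
  have hF : Measurable fun z : X × Y => ENNReal.ofReal (ψ z.1 * φ z.2 * K z.1 z.2) := by fun_prop
  rw [JJ, ofReal_integral_eq_lintegral_ofReal (JJ_bdd hKm hφ hψ).integrable
    (ae_of_all _ fun z => mul_nonneg (mul_nonneg (h0' _) (h0 _)) (hK0 _ _)),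
    lintegral_prod _ hF.aemeasurable, h'.fold _ hF.lintegral_prod_right']
  refine setLIntegral_congr_fun h'.hH fun x hx => ?_
  have q1 : ∀ x : X, Measurable fun y => ENNReal.ofReal (ψ x * φ y * K x y) := fun x =>
    hF.comp measurable_prodMk_left
  simp only
  rw [h.fold _ (q1 x), h.fold _ (q1 (τ' x))]
  have q2 : ∀ x : X, Measurable fun y => ENNReal.ofReal (m y ^ D) * ENNReal.ofReal (ψ x * φ (τ y) * K x (τ y)) :=
    fun x => (by fun_prop : Measurable fun y => ENNReal.ofReal (m y ^ D)).mul ((q1 x).comp h1)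
  have q3 : ∀ x : X, Measurable fun y => ENNReal.ofReal (ψ x * φ y * K x y) +
      ENNReal.ofReal (m y ^ D) * ENNReal.ofReal (ψ x * φ (τ y) * K x (τ y)) :=
    fun x => (q1 x).add (q2 x)
  rw [← lintegral_const_mul _ (q3 _), ← lintegral_add_left (q3 _)]
  refine setLIntegral_congr_fun h.hH fun y hy => ?_
  have p1 := h.pos y hy
  have p2 := h'.pos x hx
  have g : ∀ x y, 0 ≤ ψ x * φ y * K x y := fun x y => mul_nonneg (mul_nonneg (h0' _) (h0 _)) (hK0 _ _)
  have g1 := g x y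
  have g2 := g x (τ y)
  have g3 := g (τ' x) y
  have g4 := g (τ' x) (τ y)
  have g5 : 0 ≤ m y ^ D := by positivity
  have g6 : 0 ≤ m' x ^ D' := by positivity
  rw [FF, ← ENNReal.ofReal_mul g5, ← ENNReal.ofReal_mul g5, ← ENNReal.ofReal_add g1 (mul_nonneg g5 g2),
    ← ENNReal.ofReal_add g3 (mul_nonneg g5 g4), ← ENNReal.ofReal_mul g6,
    ← ENNReal.ofReal_add (add_nonneg g1 (mul_nonneg g5 g2))
      (mul_nonneg g6 (add_nonneg g3 (mul_nonneg g5 g4)))]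

lemma JJ_pol [IsFiniteMeasure μ] [IsFiniteMeasure ν] (h : Fold μ D τ m H) (h' : Fold ν D' τ' m' H')
    {K : X → Y → ℝ} (hKm : BddM fun z : X × Y => K z.1 z.2) (hK0 : ∀ x y, 0 ≤ K x y)
    {c C e e' l : ℝ} (hc : 0 < c) (he : 0 < e) (he' : 0 < e') (hl : e = D + l) (hl' : e' = D' + l)
    {φ : Y → ℝ} {ψ : X → ℝ} (hφ : Band c C φ) (hψ : Band c C ψ)
    (hK1 : ∀ x ∈ H', ∀ y ∈ H, K (τ' x) (τ y) = m' x ^ l * m y ^ l * K x y)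
    (hK2 : ∀ x ∈ H', ∀ y ∈ H, m y ^ l * K (τ' x) y = m' x ^ l * K x (τ y))
    (hK3 : ∀ x ∈ H', ∀ y ∈ H, m y ^ l * K x y ≤ K x (τ y)) :
    JJ μ ν K (Pol τ m H e φ) (Pol τ' m' H' e' ψ) ≤ JJ μ ν K φ ψ := by
  have hP := Pol_band h hc he hφ
  have hP' := Pol_band h' hc he' hψ
  have hn : 0 ≤ JJ μ ν K φ ψ := integral_nonneg fun z =>
    mul_nonneg (mul_nonneg (hc.le.trans (hψ.2 _).1) (hc.le.trans (hφ.2 _).1)) (hK0 _ _)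
  rw [← ENNReal.ofReal_le_ofReal_iff hn,
    JJ_fold h h' hKm hK0 hP.bddM hP'.bddM (fun y => hc.le.trans (hP.2 _).1) (fun y => hc.le.trans (hP'.2 _).1),
    JJ_fold h h' hKm hK0 hφ.bddM hψ.bddM (fun y => hc.le.trans (hφ.2 _).1) (fun y => hc.le.trans (hψ.2 _).1)]
  refine setLIntegral_mono_ae' h'.hH (ae_of_all _ fun x hx => ?_)
  refine setLIntegral_mono_ae' h.hH (ae_of_all _ fun y hy => ENNReal.ofReal_le_ofReal ?_)
  have p1 := h.pos y hy
  have p2 := h'.pos x hx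
  have r1 : 0 < m y ^ l := Real.rpow_pos_of_pos p1 _
  have r2 : 0 < m' x ^ l := Real.rpow_pos_of_pos p2 _
  have E : ∀ (φ : Y → ℝ) (ψ : X → ℝ), FF K D D' τ m τ' m' φ ψ x y =
      (ψ x * φ y + (m' x ^ e' * ψ (τ' x)) * (m y ^ e * φ (τ y))) * K x y +
      (ψ x * (m y ^ e * φ (τ y)) + (m' x ^ e' * ψ (τ' x)) * φ y) * (K x (τ y) / m y ^ l) := by
    intro φ ψ
    have hk2 : K (τ' x) y = m' x ^ l * K x (τ y) / m y ^ l := by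
      rw [eq_div_iff r1.ne', ← hK2 x hx y hy]; ring
    rw [FF, hl, hl', Real.rpow_add p1, Real.rpow_add p2, hK1 x hx y hy, hk2]
    field_simp
    ring
  rw [E, E, Pol_tau h hy, Pol_tau h' hx, Pol_mem hy, Pol_mem hx]
  apply rearr
  rw [le_div_iff₀ r1, mul_comm]
  exact hK3 x hx y hy

end

end

section

open EuclideanGeometry (inversion)

/-- embedding of the boundary -/
noncomputable def emd (d : ℕ) (y : Eu d) : Eu (d + 1) := emb (d + 1) y

lemma emd_castSucc (d : ℕ) (y : Eu d) (i : Fin d) : emd d y i.castSucc = y i := by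
  simp [emd, emb, EuclideanSpace.equiv]

lemma emd_last (d : ℕ) (y : Eu d) : emd d y (Fin.last d) = 0 := by
  simp [emd, emb, EuclideanSpace.equiv]

lemma xo_castSucc (d : ℕ) (i : Fin d) : xo (d+1) i.castSucc = 0 := by
  have := i.2.ne
  simp [xo, EuclideanSpace.equiv, this]

lemma xo_last (d : ℕ) : xo (d+1) (Fin.last d) = -2 := by
  simp [xo, EuclideanSpace.equiv]

lemma zo_castSucc (d : ℕ) (i : Fin d) : zo (d+1) i.castSucc = 0 := by
  have := i.2.ne
  simp [zo, EuclideanSpace.equiv, this]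

lemma zo_last (d : ℕ) : zo (d+1) (Fin.last d) = -1 := by
  simp [zo, EuclideanSpace.equiv]

lemma mem_U {d : ℕ} {x : Eu (d+1)} : x ∈ upperHalf (d+1) ↔ 0 < x (Fin.last d) := by
  simp [upperHalf, lastCoord]
  rfl

lemma nsq {d : ℕ} (x : Eu (d+1)) : ‖x‖ ^ 2 = ∑ i : Fin d, x i.castSucc ^ 2 + x (Fin.last d) ^ 2 := by
  rw [EuclideanSpace.real_norm_sq_eq, Fin.sum_univ_castSucc]

lemma nsq' {d : ℕ} (x : Eu d) : ‖x‖ ^ 2 = ∑ i : Fin d, x i ^ 2 := by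
  rw [EuclideanSpace.real_norm_sq_eq]

lemma emd_ext {d : ℕ} {x y : Eu (d+1)} (h : ∀ i : Fin d, x i.castSucc = y i.castSucc)
    (h' : x (Fin.last d) = y (Fin.last d)) : x = y := by
  ext i
  refine Fin.lastCases h' h i

noncomputable def emL (d : ℕ) : Eu d →ₗᵢ[ℝ] Eu (d+1) where
  toFun := emd d
  map_add' x y := emd_ext (by simp [emd_castSucc]) (by simp [emd_last])
  map_smul' c x := emd_ext (by simp [emd_castSucc]) (by simp [emd_last])
  norm_map' x := by
    have : ‖emd d x‖ ^ 2 = ‖x‖ ^ 2 := by rw [nsq, nsq']; simp [emd_castSucc, emd_last]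
    exact (sq_eq_sq₀ (norm_nonneg _) (norm_nonneg _)).1 this

lemma emd_dist {d : ℕ} (x y : Eu d) : dist (emd d x) (emd d y) = dist x y := (emL d).dist_map x y

lemma emd_inj {d : ℕ} {x y : Eu d} : emd d x = emd d y ↔ x = y := (emL d).injective.eq_iff

lemma emd_cont {d : ℕ} : Continuous (emd d) := (emL d).continuous

lemma emd_meas {d : ℕ} : Measurable (emd d) := emd_cont.measurable

lemma emd_tau {d : ℕ} (a y : Eu d) (ρ : ℝ) : emd d (inversion a ρ y) = inversion (emd d a) ρ (emd d y) := by
  simp only [inversion, emd_dist, vsub_eq_sub, vadd_eq_add]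
  exact ((emL d).map_add _ _).trans (by rw [(emL d).map_smul, (emL d).map_sub]; rfl)

lemma emd_xo_sq {d : ℕ} (y : Eu d) : dist (emd d y) (xo (d+1)) ^ 2 = 4 + ‖y‖ ^ 2 := by
  rw [dist_eq_norm, nsq, nsq']
  simp [emd_castSucc, emd_last, xo_castSucc, xo_last]
  ring

lemma emd_ne_xo {d : ℕ} (y : Eu d) : emd d y ≠ xo (d+1) := by
  intro h
  have := emd_xo_sq y
  rw [h, dist_self] at this
  nlinarith [norm_nonneg y]

lemma U_ne_xo {d : ℕ} {x : Eu (d+1)} (hx : x ∈ upperHalf (d+1)) : x ≠ xo (d+1) := by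
  rintro rfl
  rw [mem_U, xo_last] at hx
  norm_num at hx

lemma U_ne_em {d : ℕ} {x : Eu (d+1)} (hx : x ∈ upperHalf (d+1)) (a : Eu d) : x ≠ emd d a := by
  rintro rfl
  rw [mem_U, emd_last] at hx
  norm_num at hx

lemma U_meas {d : ℕ} : MeasurableSet (upperHalf (d+1)) := by
  have : upperHalf (d+1) = {x : Eu (d+1) | 0 < x (Fin.last d)} := by ext x; exact mem_U
  rw [this]
  exact measurableSet_lt measurable_const (by fun_prop)

lemma tau_U {d : ℕ} {x : Eu (d+1)} (hx : x ∈ upperHalf (d+1)) (a : Eu d) {ρ : ℝ} (hρ : 0 < ρ) :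
    inversion (emd d a) ρ x ∈ upperHalf (d+1) := by
  have h1 := U_ne_em hx a
  rw [mem_U] at *
  have : 0 < dist x (emd d a) := dist_pos.2 h1
  simp only [inversion, vsub_eq_sub, vadd_eq_add, PiLp.add_apply, PiLp.smul_apply, PiLp.sub_apply, emd_last]
  simp
  positivity

lemma inversion_meas {N : ℕ} (a : Eu N) (ρ : ℝ) : Measurable (inversion a ρ) := by
  unfold inversion
  simp only [vsub_eq_sub, vadd_eq_add]
  fun_prop

/-- key identity -/
lemma inv_key {N : ℕ} {a y : Eu N} (z : Eu N) {ρ : ℝ} (hy : y ≠ a) :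
    dist (inversion a ρ y) z ^ 2 * dist y a ^ 2 =
      ρ ^ 2 * dist y z ^ 2 + (dist y a ^ 2 - ρ ^ 2) * (dist z a ^ 2 - ρ ^ 2) := by
  have h0 : dist y a ≠ 0 := (dist_pos.2 hy).ne'
  have e1 : inversion a ρ y - z = (ρ / dist y a) ^ 2 • (y - a) - (z - a) := by
    simp only [inversion, vsub_eq_sub, vadd_eq_add]; abel
  have e2 : y - z = (y - a) - (z - a) := by abel
  rw [dist_eq_norm (inversion a ρ y) z, e1, dist_eq_norm y z, e2,
    @norm_sub_sq ℝ _ _ _ _ ((ρ / dist y a) ^ 2 • (y - a)) (z - a), @norm_sub_sq ℝ _ _ _ _ (y - a) (z - a),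
    norm_smul, inner_smul_left, ← dist_eq_norm y a, ← dist_eq_norm z a, Real.norm_of_nonneg (by positivity)]
  simp only [conj_trivial, RCLike.re_to_real]
  field_simp
  ring

lemma inv_cov {N : ℕ} (a : Eu N) (ρ : ℝ) (hρ : 0 < ρ) {s : Set (Eu N)} (hs : MeasurableSet s)
    (ha : a ∉ s) (G : Eu N → ℝ≥0∞) :
    ∫⁻ x in inversion a ρ '' s, G x = ∫⁻ x in s, ENNReal.ofReal (((ρ / dist x a) ^ 2) ^ N) *
      G (inversion a ρ x) := by
  rw [lintegral_image_eq_lintegral_abs_det_fderiv_mul volume hs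
    (fun x hx => (EuclideanGeometry.hasFDerivAt_inversion (R := ρ)
      (fun h : x = a => ha (h ▸ hx))).hasFDerivWithinAt)
    (EuclideanGeometry.inversion_injective a hρ.ne').injOn]
  refine setLIntegral_congr_fun hs fun x hx => ?_
  congr 2
  rw [ContinuousLinearMap.det, ContinuousLinearMap.coe_smul, LinearMap.det_smul, abs_mul]
  have : LinearMap.det ((((Submodule.span ℝ {x - a})ᗮ).reflection : Eu N →L[ℝ] Eu N) : Eu N →ₗ[ℝ] Eu N) =
    LinearMap.det (((Submodule.span ℝ {x - a})ᗮ).reflection).toLinearMap := rfl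
  rw [this, Submodule.det_reflection, abs_pow (-1 : ℝ), abs_neg, abs_one, one_pow, mul_one, abs_of_nonneg (by positivity)]
  simp

/-- conformal factor change -/
noncomputable def mm {N : ℕ} (w : Eu N → ℝ) (a : Eu N) (ρ : ℝ) (x : Eu N) : ℝ :=
  (ρ / dist x a) ^ 2 * w (inversion a ρ x) / w x

/-- half-space -/
def HH {N : ℕ} (U : Set (Eu N)) (a : Eu N) (ρ θ : ℝ) : Set (Eu N) :=
  {x | x ∈ U ∧ x ≠ a ∧ 0 < θ * (dist x a ^ 2 - ρ ^ 2)}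

/-- weighted measure -/
noncomputable def wM {N : ℕ} (U : Set (Eu N)) (w : Eu N → ℝ) : Measure (Eu N) :=
  ((volume : Measure (Eu N)).restrict U).withDensity fun x => ENNReal.ofReal (w x ^ N)

lemma fold_gen {N : ℕ} (hN : 0 < N) {U : Set (Eu N)} (hU : MeasurableSet U) {w : Eu N → ℝ}
    (hw : Measurable w) (hw0 : ∀ x ∈ U, 0 < w x) {a : Eu N} {ρ θ : ℝ} (hρ : 0 < ρ) (hθ : θ ≠ 0)
    (hUτ : ∀ x ∈ U, inversion a ρ x ∈ U)
    (hlt : ∀ x ∈ HH U a ρ θ, mm w a ρ x < 1) :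
    Fold (wM U w) N (inversion a ρ) (mm w a ρ) (HH U a ρ θ) := by
  have hτ := inversion_meas a ρ
  have hH : MeasurableSet (HH U a ρ θ) := by
    refine hU.inter (MeasurableSet.inter (measurableSet_singleton a).compl ?_)
    exact measurableSet_lt (f := fun _ => (0:ℝ)) measurable_const (g := fun x : Eu N => θ * (dist x a ^ 2 - ρ ^ 2)) (by fun_prop)
  have hm : Measurable (mm w a ρ) := by
    have h1 := hw.comp hτ
    unfold mm
    exact ((by fun_prop : Measurable fun x : Eu N => (ρ / dist x a) ^ 2).mul h1).div hw
  have hpos : ∀ y ∈ HH U a ρ θ, 0 < mm w a ρ y := by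
    rintro y ⟨h1, h2, -⟩
    have := dist_pos.2 h2
    have := hw0 _ h1
    have := hw0 _ (hUτ _ h1)
    unfold mm
    positivity
  have hsgn : ∀ y ≠ a, dist (inversion a ρ y) a ^ 2 - ρ ^ 2 =
      - (ρ / dist y a) ^ 2 * (dist y a ^ 2 - ρ ^ 2) := by
    intro y hy
    have := dist_pos.2 hy
    rw [EuclideanGeometry.dist_inversion_center]
    field_simp
    ring
  have hinv : ∀ y, inversion a ρ (inversion a ρ y) = y := EuclideanGeometry.inversion_inversion a hρ.ne'
  have hnmem : ∀ y ∈ HH U a ρ θ, inversion a ρ y ∉ HH U a ρ θ := by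
    rintro y ⟨h1, h2, h3⟩ ⟨h4, h5, h6⟩
    rw [hsgn y h2] at h6
    have : 0 ≤ (ρ / dist y a) ^ 2 := by positivity
    nlinarith
  refine ⟨hτ, hm, hH, fun y _ => hinv y, hnmem, hpos, hlt, fun G hG => ?_⟩
  have hN' : Nontrivial (Eu N) := by
    have : Nonempty (Fin N) := ⟨⟨0, hN⟩⟩
    infer_instance
  have hH' : MeasurableSet (inversion a ρ '' HH U a ρ θ) := by
    have : inversion a ρ '' HH U a ρ θ = inversion a ρ ⁻¹' HH U a ρ θ :=
      (EuclideanGeometry.inversion_involutive a hρ.ne').image_eq_preimage_symm ▸ rfl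
    rw [this]; exact hτ hH
  have hUe : (U : Set (Eu N)) =ᵐ[volume] (HH U a ρ θ ∪ inversion a ρ '' HH U a ρ θ : Set (Eu N)) := by
    have n1 : ∀ᵐ x : Eu N, x ∉ sphere a ρ := by
      rw [← measure_eq_zero_iff_ae_notMem]; exact Measure.addHaar_sphere _ _ _
    have n2 : ∀ᵐ x : Eu N, x ∉ ({a} : Set (Eu N)) := by
      rw [← measure_eq_zero_iff_ae_notMem]; exact measure_singleton a
    filter_upwards [n1, n2] with x h1 h2
    have h2' : x ≠ a := h2
    have h1' : dist x a ^ 2 - ρ ^ 2 ≠ 0 := by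
      intro h
      apply h1
      rw [mem_sphere]
      exact (sq_eq_sq₀ dist_nonneg hρ.le).1 (by linarith)
    apply propext
    constructor
    · intro hx
      rcases (mul_ne_zero hθ h1').lt_or_gt with h | h
      · refine Or.inr ⟨inversion a ρ x, ⟨hUτ x hx, ?_, ?_⟩, hinv x⟩
        · rw [Ne, EuclideanGeometry.inversion_eq_center hρ.ne']; exact h2'
        · rw [hsgn x h2']
          have h5 := dist_pos.2 h2'
          have : 0 < (ρ / dist x a) ^ 2 := by positivity
          nlinarith
      · exact Or.inl ⟨hx, h2', h⟩
    · rintro (⟨h, -⟩ | ⟨y, ⟨h, -⟩, rfl⟩)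
      · exact h
      · exact hUτ y h
  have hdisj : Disjoint (HH U a ρ θ) (inversion a ρ '' HH U a ρ θ) := by
    rw [Set.disjoint_right]
    rintro _ ⟨y, hy, rfl⟩
    exact hnmem y hy
  have hwm : Measurable fun x => ENNReal.ofReal (w x ^ N) := by fun_prop
  have hG2 : Measurable fun y => G y + ENNReal.ofReal (mm w a ρ y ^ (N : ℝ)) * G (inversion a ρ y) :=
    hG.add ((by fun_prop : Measurable fun y => ENNReal.ofReal (mm w a ρ y ^ (N : ℝ))).mul (hG.comp hτ))
  rw [wM, lintegral_withDensity_eq_lintegral_mul _ hwm hG, setLIntegral_congr hUe,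
    lintegral_union hH' hdisj, inv_cov a ρ hρ hH (fun h => h.2.1 rfl), restrict_withDensity hH,
    lintegral_withDensity_eq_lintegral_mul _ hwm hG2, Measure.restrict_restrict hH,
    ← lintegral_add_left (hwm.mul hG)]
  have : HH U a ρ θ ∩ U = HH U a ρ θ := Set.inter_eq_left.2 fun x hx => hx.1
  rw [this]
  refine setLIntegral_congr_fun hH fun x hx => ?_
  simp only [Pi.mul_apply]
  rw [mul_add, ← mul_assoc, ← mul_assoc, Real.rpow_natCast, ← ENNReal.ofReal_mul (by positivity),
    ← ENNReal.ofReal_mul (pow_nonneg (hw0 x hx.1).le _), ← mul_pow, ← mul_pow]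
  have := (hw0 x hx.1).ne'
  congr 4
  rw [mm]; field_simp

end

section

open EuclideanGeometry (inversion)

/-- conformal factor on the half space -/
noncomputable def wX (d : ℕ) (x : Eu (d+1)) : ℝ := 4 / dist x (xo (d+1)) ^ 2

/-- conformal factor on the boundary -/
noncomputable def wY (d : ℕ) (y : Eu d) : ℝ := wX d (emd d y)

/-- the measure on the boundary -/
noncomputable def muY (d : ℕ) : Measure (Eu d) := wM Set.univ (wY d)

/-- the measure on the half space -/
noncomputable def nuX (d : ℕ) : Measure (Eu (d+1)) := wM (upperHalf (d+1)) (wX d)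

open Classical in
/-- inversion of the half space onto the ball -/
noncomputable def aX (d : ℕ) (x : Eu (d+1)) : Eu (d+1) :=
  if x ∈ upperHalf (d+1) then inversion (xo (d+1)) 2 x else zo (d+1)

/-- inversion of the boundary onto the sphere -/
noncomputable def bY (d : ℕ) (y : Eu d) : Eu (d+1) := inversion (xo (d+1)) 2 (emd d y)

/-- the kernel -/
noncomputable def KK (d : ℕ) (l : ℝ) (x : Eu (d+1)) (y : Eu d) : ℝ := ‖aX d x - bY d y‖ ^ (2 * l)

lemma wX_meas {d : ℕ} : Measurable (wX d) := by unfold wX; fun_prop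

lemma wY_meas {d : ℕ} : Measurable (wY d) := wX_meas.comp emd_meas

lemma wX_pos {d : ℕ} {x : Eu (d+1)} (hx : x ≠ xo (d+1)) : 0 < wX d x := by
  have := dist_pos.2 hx
  unfold wX; positivity

lemma wY_pos {d : ℕ} (y : Eu d) : 0 < wY d y := wX_pos (emd_ne_xo y)

lemma wY_eq {d : ℕ} (y : Eu d) : wY d y = 4 / (4 + ‖y‖ ^ 2) := by
  rw [wY, wX, emd_xo_sq]

lemma dist_zo_xo {d : ℕ} : dist (zo (d+1)) (xo (d+1)) = 1 := by
  have : dist (zo (d+1)) (xo (d+1)) ^ 2 = 1 ^ 2 := by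
    rw [dist_eq_norm, nsq]
    simp [zo_castSucc, zo_last, xo_castSucc, xo_last]
    norm_num
  exact (sq_eq_sq₀ dist_nonneg zero_le_one).1 this

lemma inv_zo {d : ℕ} {x : Eu (d+1)} (hx : x ≠ xo (d+1)) :
    dist (inversion (xo (d+1)) 2 x) (zo (d+1)) ^ 2 * dist x (xo (d+1)) ^ 2 =
      dist x (xo (d+1)) ^ 2 - 8 * x (Fin.last d) := by
  rw [inv_key _ hx, dist_zo_xo, dist_eq_norm x (zo _), dist_eq_norm x (xo _), nsq, nsq]
  simp [zo_castSucc, zo_last, xo_castSucc, xo_last]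
  ring

lemma aX_mem {d : ℕ} (x : Eu (d+1)) : dist (aX d x) (zo (d+1)) < 1 := by
  unfold aX
  split_ifs with h
  · have h1 := inv_zo (U_ne_xo h)
    have h2 := dist_pos.2 (U_ne_xo h)
    rw [mem_U] at h
    by_contra h3
    push Not at h3
    have h4 : 1 ≤ dist (inversion (xo (d+1)) 2 x) (zo (d+1)) ^ 2 := one_le_pow₀ h3
    have h5 : 0 < dist x (xo (d+1)) ^ 2 := by positivity
    nlinarith
  · simp

lemma bY_mem {d : ℕ} (y : Eu d) : dist (bY d y) (zo (d+1)) = 1 := by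
  have h1 := inv_zo (emd_ne_xo y)
  have h2 := dist_pos.2 (emd_ne_xo y)
  rw [emd_last, mul_zero, sub_zero] at h1
  have h3 : dist (bY d y) (zo (d+1)) ^ 2 = 1 ^ 2 := by
    rw [bY]
    have h5 : dist (emd d y) (xo (d+1)) ^ 2 ≠ 0 := by positivity
    rw [one_pow]
    exact mul_right_cancel₀ h5 (by rw [h1, one_mul])
  exact (sq_eq_sq₀ dist_nonneg zero_le_one).1 h3

lemma aX_meas {d : ℕ} : Measurable (aX d) :=
  Measurable.ite U_meas (inversion_meas _ _) measurable_const

lemma bY_meas {d : ℕ} : Measurable (bY d) := (inversion_meas _ _).comp emd_meas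

lemma norm_zo {d : ℕ} : ‖zo (d+1)‖ = 1 := by
  have : ‖zo (d+1)‖ ^ 2 = 1 ^ 2 := by
    rw [nsq]; simp [zo_castSucc, zo_last]
  exact (sq_eq_sq₀ (norm_nonneg _) zero_le_one).1 this

lemma norm_le_two {d : ℕ} {x : Eu (d+1)} (h : dist x (zo (d+1)) ≤ 1) : ‖x‖ ≤ 2 := by
  have h1 : ‖x‖ ≤ ‖x - zo (d+1)‖ + ‖zo (d+1)‖ := norm_le_norm_sub_add _ _
  rw [← dist_eq_norm, norm_zo] at h1
  linarith

lemma KK_ufr {d : ℕ} {l : ℝ} (hl : 0 < l) : UFR (KK d l) :=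
  ufr_norm (M := 2) aX_meas bY_meas (fun x => norm_le_two (aX_mem x).le) (fun y => norm_le_two (bY_mem y).le)
    (by linarith)

lemma KK_nonneg {d : ℕ} {l : ℝ} (x : Eu (d+1)) (y : Eu d) : 0 ≤ KK d l x y := by
  unfold KK; positivity

lemma KK_le {d : ℕ} {l : ℝ} (hl : 0 < l) (x : Eu (d+1)) (y : Eu d) : KK d l x y ≤ 2 ^ (2 * l) := by
  have h1 := (aX_mem x).le
  have h2 := (bY_mem y).le
  have : ‖aX d x - bY d y‖ ≤ 2 := by
    rw [← dist_eq_norm]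
    linarith [dist_triangle_right (aX d x) (bY d y) (zo (d+1))]
  exact Real.rpow_le_rpow (norm_nonneg _) this (by linarith)

lemma KK_bddM {d : ℕ} {l : ℝ} (hl : 0 < l) : BddM fun z : Eu (d+1) × Eu d => KK d l z.1 z.2 := by
  refine ⟨?_, 2 ^ (2 * l), fun z => ?_⟩
  · unfold KK
    exact (((aX_meas.comp measurable_fst).sub (bY_meas.comp measurable_snd)).norm).pow_const _
  · rw [abs_of_nonneg (KK_nonneg _ _)]
    exact KK_le hl _ _

lemma KK_eq {d : ℕ} {l : ℝ} {x : Eu (d+1)} (hx : x ∈ upperHalf (d+1)) (y : Eu d) :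
    KK d l x y = (wX d x * wY d y * dist x (emd d y) ^ 2) ^ l := by
  have h1 := dist_pos.2 (U_ne_xo hx)
  have h2 := dist_pos.2 (emd_ne_xo y)
  rw [KK, Real.rpow_mul (norm_nonneg _), ← dist_eq_norm, aX, if_pos hx, bY,
    EuclideanGeometry.dist_inversion_inversion (U_ne_xo hx) (emd_ne_xo y), wY, wX, wX]
  congr 1
  rw [Real.rpow_two]
  field_simp
  ring

lemma mm_wX {d : ℕ} {a : Eu (d+1)} {ρ : ℝ} {x : Eu (d+1)} (hx : x ≠ xo (d+1)) :
    mm (wX d) a ρ x * wX d x = (ρ / dist x a) ^ 2 * wX d (inversion a ρ x) := by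
  have := wX_pos hx
  unfold mm
  field_simp

lemma mm_emd {d : ℕ} {a : Eu d} {ρ : ℝ} {y : Eu d} :
    mm (wY d) a ρ y = mm (wX d) (emd d a) ρ (emd d y) := by
  unfold mm wY
  rw [emd_tau, emd_dist]

lemma mm_lt {d : ℕ} {a x : Eu (d+1)} {ρ : ℝ} (hρ : 0 < ρ) (hxa : x ≠ a) (hx : x ≠ xo (d+1))
    (hx' : inversion a ρ x ≠ xo (d+1))
    (h : 0 < (dist (xo (d+1)) a ^ 2 - ρ ^ 2) * (dist x a ^ 2 - ρ ^ 2)) :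
    mm (wX d) a ρ x < 1 := by
  have h1 := dist_pos.2 hxa
  have h2 := dist_pos.2 hx
  have h3 := dist_pos.2 hx'
  have h4 := inv_key (ρ := ρ) (xo (d+1)) hxa
  unfold mm wX
  have : (ρ / dist x a) ^ 2 * (4 / dist (inversion a ρ x) (xo (d + 1)) ^ 2) / (4 / dist x (xo (d + 1)) ^ 2)
    = (ρ ^ 2 * dist x (xo (d+1)) ^ 2) / (dist (inversion a ρ x) (xo (d + 1)) ^ 2 * dist x a ^ 2) := by
    field_simp
  rw [this, div_lt_one (by positivity), h4]
  linarith

section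
variable {d : ℕ} (a : Eu d) {ρ θ : ℝ} (hρ : 0 < ρ) (hθ : θ = dist (xo (d+1)) (emd d a) ^ 2 - ρ ^ 2)
  (hθ0 : θ ≠ 0)

lemma foldX (hρ : 0 < ρ) (hθ : θ = dist (xo (d+1)) (emd d a) ^ 2 - ρ ^ 2)
    (hθ0 : θ ≠ 0) : Fold (nuX d) ((d+1 : ℕ) : ℝ) (inversion (emd d a) ρ) (mm (wX d) (emd d a) ρ)
    (HH (upperHalf (d+1)) (emd d a) ρ θ) := by
  refine fold_gen (Nat.succ_pos d) U_meas wX_meas (fun x hx => wX_pos (U_ne_xo hx)) hρ hθ0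
    (fun x hx => tau_U hx a hρ) fun x hx => ?_
  exact mm_lt hρ hx.2.1 (U_ne_xo hx.1) (U_ne_xo (tau_U hx.1 a hρ)) (hθ ▸ hx.2.2)

lemma foldY (hd : 0 < d) (hρ : 0 < ρ) (hθ : θ = dist (xo (d+1)) (emd d a) ^ 2 - ρ ^ 2)
    (hθ0 : θ ≠ 0) : Fold (muY d) (d : ℝ) (inversion a ρ) (mm (wY d) a ρ)
    (HH Set.univ a ρ θ) := by
  refine fold_gen hd MeasurableSet.univ wY_meas (fun x hx => wY_pos x) hρ hθ0
    (fun x hx => trivial) fun x hx => ?_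
  rw [mm_emd]
  refine mm_lt hρ (emd_inj.not.2 hx.2.1) (emd_ne_xo x) ?_ ?_
  · rw [← emd_tau]; exact emd_ne_xo _
  · rw [emd_dist]; exact hθ ▸ hx.2.2

lemma pol_step [IsFiniteMeasure (muY d)] [IsFiniteMeasure (nuX d)] (hd : 0 < d) (hρ : 0 < ρ)
    (hθ : θ = dist (xo (d+1)) (emd d a) ^ 2 - ρ ^ 2)
    (hθ0 : θ ≠ 0) {c C l p t : ℝ} (hc : 0 < c) (hl : 0 < l) (hp : p * (d + l) = d)
    (ht : t * ((d+1 : ℕ) + l) = (d+1 : ℕ)) {φ : Eu d → ℝ} {ψ : Eu (d+1) → ℝ}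
    (hφ : Band c C φ) (hψ : Band c C ψ) :
    (∀ᵐ y ∂(muY d), y ∈ HH Set.univ a ρ θ →
      mm (wY d) a ρ y ^ (d + l) * φ (inversion a ρ y) ≤ φ y) ∨
    ∃ φ' ψ', Band c C φ' ∧ Band c C ψ' ∧ ∫ y, φ' y ^ p ∂(muY d) = ∫ y, φ y ^ p ∂(muY d) ∧
        ∫ x, ψ' x ^ t ∂(nuX d) = ∫ x, ψ x ^ t ∂(nuX d) ∧
        JJ (muY d) (nuX d) (KK d l) φ' ψ' ≤ JJ (muY d) (nuX d) (KK d l) φ ψ ∧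
        ∫ y, φ y ^ (p / 2) ∂(muY d) < ∫ y, φ' y ^ (p / 2) ∂(muY d) := by
  have FY := foldY a hd hρ hθ hθ0
  have FX := foldX a hρ hθ hθ0
  have hd' : (0:ℝ) < d := by exact_mod_cast hd
  have hp0 : 0 < p := by
    by_contra h
    push Not at h
    nlinarith
  have he : 0 < d + l := by linarith
  have he' : 0 < ((d+1 : ℕ) : ℝ) + l := by positivity
  refine (Pol_strict FY hd' hc he hφ (q := p / 2) (by linarith) (by linarith)).imp id fun hs => ?_
  refine ⟨_, Pol _ _ _ _ ψ, Pol_band FY hc he hφ, Pol_band FX hc he' hψ, Pol_pow FY hc he hφ hp,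
    Pol_pow FX hc he' hψ ht, ?_, hs⟩
  have g0 : ∀ x ∈ HH (upperHalf (d+1)) (emd d a) ρ θ, ∀ y ∈ HH Set.univ a ρ θ, 
      0 < mm (wX d) (emd d a) ρ x ∧ 0 < mm (wY d) a ρ y ∧ 0 < wX d x ∧ 0 < wY d y ∧
      0 < dist x (emd d a) ∧ 0 < dist (emd d y) (emd d a) ∧
      mm (wX d) (emd d a) ρ x * wX d x = (ρ / dist x (emd d a)) ^ 2 * wX d (inversion (emd d a) ρ x) ∧
      mm (wY d) a ρ y * wY d y = (ρ / dist (emd d y) (emd d a)) ^ 2 * wY d (inversion a ρ y) := by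
    intro x hx y hy
    refine ⟨FX.pos x hx, FY.pos y hy, wX_pos (U_ne_xo hx.1), wY_pos y, dist_pos.2 hx.2.1,
      dist_pos.2 (emd_inj.not.2 hy.2.1), mm_wX (U_ne_xo hx.1), ?_⟩
    rw [mm_emd, wY, mm_wX (emd_ne_xo y), wY, emd_tau]
  refine JJ_pol FY FX (KK_bddM hl) KK_nonneg hc he he' rfl rfl hφ hψ ?_ ?_ ?_
  · intro x hx y hy
    obtain ⟨p1, p2, p3, p4, p5, p6, e1, e2⟩ := g0 x hx y hy
    rw [KK_eq hx.1, KK_eq (tau_U hx.1 a hρ), ← Real.mul_rpow p1.le p2.le,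
      ← Real.mul_rpow (by positivity) (by positivity), emd_tau,
      EuclideanGeometry.dist_inversion_inversion hx.2.1 (emd_inj.not.2 hy.2.1)]
    congr 1
    calc _ = ((ρ / dist x (emd d a)) ^ 2 * wX d (inversion (emd d a) ρ x)) *
          ((ρ / dist (emd d y) (emd d a)) ^ 2 * wY d (inversion a ρ y)) * dist x (emd d y) ^ 2 := by
          field_simp
      _ = _ := by rw [← e1, ← e2]; ring
  · intro x hx y hy
    obtain ⟨p1, p2, p3, p4, p5, p6, e1, e2⟩ := g0 x hx y hy
    have q1 := wX_pos (U_ne_xo (tau_U hx.1 a hρ))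
    have q2 := wY_pos (inversion a ρ y)
    rw [KK_eq hx.1, KK_eq (tau_U hx.1 a hρ), ← Real.mul_rpow p2.le (by positivity),
      ← Real.mul_rpow p1.le (by positivity), emd_tau]
    congr 1
    have h6 := EuclideanGeometry.dist_inversion_mul_dist_center_eq (R := ρ) hx.2.1 (emd_inj.not.2 hy.2.1)
    calc _ = wX d (inversion (emd d a) ρ x) * (mm (wY d) a ρ y * wY d y) *
          dist (inversion (emd d a) ρ x) (emd d y) ^ 2 := by ring
      _ = wX d (inversion (emd d a) ρ x) * wY d (inversion a ρ y) * ρ ^ 2 *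
         (dist (inversion (emd d a) ρ x) (emd d y) * dist x (emd d a)) ^ 2 / (dist (emd d y) (emd d a) *
            dist x (emd d a)) ^ 2 := by rw [e2]; field_simp
      _ = (mm (wX d) (emd d a) ρ x * wX d x) * wY d (inversion a ρ y) * 
            dist x (inversion (emd d a) ρ (emd d y)) ^ 2 := by rw [e1, h6]; field_simp
      _ = _ := by ring
  · intro x hx y hy
    obtain ⟨p1, p2, p3, p4, p5, p6, e1, e2⟩ := g0 x hx y hy
    have q2 := wY_pos (inversion a ρ y)
    rw [KK_eq hx.1, KK_eq hx.1, ← Real.mul_rpow p2.le (by positivity), emd_tau]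
    refine Real.rpow_le_rpow (by positivity) ?_ hl.le
    have h6 := inv_key (ρ := ρ) x (emd_inj.not.2 hy.2.1)
    have h7 : 0 < (dist (emd d y) (emd d a) ^ 2 - ρ ^ 2) * (dist x (emd d a) ^ 2 - ρ ^ 2) := by
      have h8 := hx.2.2
      have h9 := hy.2.2
      rw [emd_dist]
      have := mul_pos h8 h9
      have h10 : 0 < θ ^ 2 := by positivity
      by_contra hcon
      push Not at hcon
      nlinarith
    have h8 : ρ ^ 2 * dist x (emd d y) ^ 2 ≤
        dist x (inversion (emd d a) ρ (emd d y)) ^ 2 * dist (emd d y) (emd d a) ^ 2 := by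
      rw [dist_comm x (inversion _ _ _), h6, dist_comm x (emd d y)]
      linarith
    calc _ = wX d x * (mm (wY d) a ρ y * wY d y) * dist x (emd d y) ^ 2 := by ring
      _ = wX d x * wY d (inversion a ρ y) / dist (emd d y) (emd d a) ^ 2 *
            (ρ ^ 2 * dist x (emd d y) ^ 2) := by rw [e2]; field_simp
      _ ≤ wX d x * wY d (inversion a ρ y) / dist (emd d y) (emd d a) ^ 2 * 
        (dist x (inversion (emd d a) ρ (emd d y)) ^ 2 * dist (emd d y) (emd d a) ^ 2) := by gcongr
      _ = _ := by field_simp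
end

end

section

open EuclideanGeometry (inversion)

lemma ae_affine {F : Type} [NormedAddCommGroup F] [NormedSpace ℝ F] [MeasurableSpace F] [BorelSpace F]
    [FiniteDimensional ℝ F] (μ : Measure F) [μ.IsAddHaarMeasure] {r : ℝ} (hr : r ≠ 0) (b : F)
    {P : F → Prop} (h : ∀ᵐ a ∂μ, P (b + r • a)) : ∀ᵐ z ∂μ, P z := by
  rw [ae_iff] at *
  have e : {a | ¬ P (b + r • a)} = (r • ·) ⁻¹' ((b + ·) ⁻¹' {z | ¬ P z}) := rfl
  rw [e, Measure.addHaar_preimage_smul μ hr, measure_preimage_add, mul_eq_zero] at h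
  rcases h with h | h
  · exfalso
    rw [ENNReal.ofReal_eq_zero] at h
    have : 0 < |(r ^ Module.finrank ℝ F)⁻¹| := by positivity
    linarith
  · exact h

lemma ae_muY {d : ℕ} {P : Eu d → Prop} : (∀ᵐ y ∂(muY d), P y) ↔ ∀ᵐ y, P y := by
  have := wY_meas (d := d)
  rw [muY, wM, ae_withDensity_iff (by fun_prop), Measure.restrict_univ]
  have : ∀ y : Eu d, ENNReal.ofReal (wY d y ^ d) ≠ 0 := fun y => by
    have := wY_pos y
    simp only [ne_eq, ENNReal.ofReal_eq_zero, not_le]; positivity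
  simp [this]

/-- the good set -/
def Good {d : ℕ} (φ : Eu d → ℝ) (e : ℝ) (y : Eu d) (κ : ℝ) (z : Eu d) : Prop :=
  0 < κ → κ * (4 + ‖y‖ ^ 2) < 4 + ‖z‖ ^ 2 → (κ * (4 + ‖y‖ ^ 2) / (4 + ‖z‖ ^ 2)) ^ e * φ z ≤ φ y

lemma good_meas {d : ℕ} {φ : Eu d → ℝ} (hφ : Measurable φ) (e : ℝ) {T : Type} [MeasurableSpace T]
    {f g : T → Eu d} {k : T → ℝ} (hf : Measurable f) (hg : Measurable g) (hk : Measurable k) :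
    MeasurableSet {x | Good φ e (f x) (k x) (g x)} := by
  unfold Good
  have m1 : Measurable fun x => φ (g x) := hφ.comp hg
  have m2 : Measurable fun x => φ (f x) := hφ.comp hf
  have s1 : MeasurableSet {x | 0 < k x} := measurableSet_lt measurable_const hk
  have s2 : MeasurableSet {x | k x * (4 + ‖f x‖ ^ 2) < 4 + ‖g x‖ ^ 2} :=
    measurableSet_lt (by fun_prop) (by fun_prop)
  have s3 : MeasurableSet {x | (k x * (4 + ‖f x‖ ^ 2) / (4 + ‖g x‖ ^ 2)) ^ e * φ (g x) ≤ φ (f x)} :=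
    measurableSet_le (by fun_prop) m2
  exact s1.imp (s2.imp s3)

lemma good_of {d : ℕ} {φ : Eu d → ℝ} {e : ℝ} 
    (h : ∀ (a : Eu d) (ρ θ : ℝ), 0 < ρ → θ = dist (xo (d+1)) (emd d a) ^ 2 - ρ ^ 2 → θ ≠ 0 →
      ∀ᵐ y ∂(muY d), y ∈ HH Set.univ a ρ θ → mm (wY d) a ρ y ^ e * φ (inversion a ρ y) ≤ φ y)
    (a : Eu d) (σ : ℝ) : 
    ∀ᵐ y, y ≠ a → Good φ e y (σ / dist y a ^ 2) (a + (σ / dist y a ^ 2) • (y - a)) := by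
  by_cases hσ : 0 < σ
  swap
  · refine ae_of_all _ fun y hy h0 => ?_
    have := dist_pos.2 hy
    exact absurd ((div_pos_iff_of_pos_right (by positivity)).1 h0) hσ
  set ρ := √σ with hρ
  have hρ2 : ρ ^ 2 = σ := Real.sq_sqrt hσ.le
  have hρ0 : 0 < ρ := Real.sqrt_pos.2 hσ
  set θ := dist (xo (d+1)) (emd d a) ^ 2 - ρ ^ 2 with hθ
  have hmain : ∀ y ≠ a, (4 + ‖inversion a ρ y‖ ^ 2) * dist y a ^ 2 =
      σ * (4 + ‖y‖ ^ 2) + (dist y a ^ 2 - σ) * θ := by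
    intro y hy
    have h1 := inv_key (ρ := ρ) (xo (d+1)) ((emd_inj (d := d)).not.2 hy)
    rw [← emd_tau, emd_xo_sq, emd_xo_sq, emd_dist] at h1
    rw [h1, hθ, hρ2]
  have hz : ∀ y, a + (σ / dist y a ^ 2) • (y - a) = inversion a ρ y := by
    intro y
    rw [inversion, div_pow, hρ2, vsub_eq_sub, vadd_eq_add, add_comm]
  by_cases hθ0 : θ = 0
  · refine ae_of_all _ fun y hy h0 h1 => ?_
    exfalso
    have h2 := hmain y hy
    have h3 := dist_pos.2 hy
    rw [hz, div_mul_eq_mul_div, div_lt_iff₀ (by positivity), h2, hθ0] at h1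
    linarith
  · have h1 := ae_muY.1 (h a ρ θ hρ0 hθ hθ0)
    filter_upwards [h1] with y hy hya h2 h3
    have h4 := dist_pos.2 hya
    have h5 : y ∈ HH Set.univ a ρ θ := by
      refine ⟨trivial, hya, ?_⟩
      rw [hz, div_mul_eq_mul_div, div_lt_iff₀ (by positivity), hmain y hya] at h3
      rw [hρ2]; linarith
    have h6 := hy h5
    have h7 : mm (wY d) a ρ y = σ / dist y a ^ 2 * (4 + ‖y‖ ^ 2) /
        (4 + ‖a + (σ / dist y a ^ 2) • (y - a)‖ ^ 2) := by
      rw [mm, wY_eq, wY_eq, hz, div_pow, hρ2]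
      field_simp
    rw [hz] at h7 ⊢
    rw [← h7]
    exact h6

lemma ae_const {d : ℕ} {φ : Eu d → ℝ} {e c : ℝ} (he : 0 < e) (hc : 0 < c) (hφ : Measurable φ)
    (hφc : ∀ y, c ≤ φ y)
    (h : ∀ (a : Eu d) (ρ θ : ℝ), 0 < ρ → θ = dist (xo (d+1)) (emd d a) ^ 2 - ρ ^ 2 → θ ≠ 0 →
      ∀ᵐ y ∂(muY d), y ∈ HH Set.univ a ρ θ → mm (wY d) a ρ y ^ e * φ (inversion a ρ y) ≤ φ y) :
    ∃ s : ℝ, φ =ᵐ[muY d] fun _ => s := by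
  have h1 : ∀ a : Eu d, ∀ᵐ y, ∀ᵐ σ : ℝ,
      y ≠ a → Good φ e y (σ / dist y a ^ 2) (a + (σ / dist y a ^ 2) • (y - a)) := by
    intro a
    have : ∀ᵐ σ : ℝ, ∀ᵐ y, y ≠ a → Good φ e y (σ / dist y a ^ 2) (a + (σ / dist y a ^ 2) • (y - a)) :=
      ae_of_all _ (good_of h a)
    rwa [Measure.ae_ae_comm] at this
    refine MeasurableSet.imp ?_ (good_meas hφ e measurable_snd (by fun_prop) (by fun_prop))
    exact (measurableSet_eq_fun measurable_snd measurable_const).compl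
  have h2 : ∀ a : Eu d, ∀ᵐ y, ∀ᵐ κ : ℝ, y ≠ a → Good φ e y κ (a + κ • (y - a)) := by
    intro a
    filter_upwards [h1 a] with y hy
    by_cases hya : y = a
    · simp [hya]
    have h4 := dist_pos.2 hya
    refine ae_affine volume (r := (dist y a ^ 2)⁻¹) (by positivity) 0 ?_
    filter_upwards [hy] with σ hσ
    have e1 : 0 + (dist y a ^ 2)⁻¹ • σ = σ / dist y a ^ 2 := by rw [zero_add, smul_eq_mul]; ring
    rw [e1]; exact hσ
  have h3 : ∀ᵐ y : Eu d, ∀ᵐ a : Eu d, ∀ᵐ κ : ℝ, y ≠ a → Good φ e y κ (a + κ • (y - a)) := by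
    rw [Measure.ae_ae_comm]
    · exact ae_of_all _ h2
    · have hS : MeasurableSet {z : (Eu d × Eu d) × ℝ |
          ¬ (z.1.1 ≠ z.1.2 → Good φ e z.1.1 z.2 (z.1.2 + z.2 • (z.1.1 - z.1.2)))} := by
        refine (MeasurableSet.imp ?_ (good_meas hφ e (by fun_prop) (by fun_prop) (by fun_prop))).compl
        exact (measurableSet_eq_fun (by fun_prop) (by fun_prop)).compl
      exact (measurable_measure_prodMk_left (ν := (volume : Measure ℝ)) hS) (measurableSet_singleton 0)
  have h4 : ∀ᵐ y : Eu d, ∀ᵐ z : Eu d, ∀ᵐ κ : ℝ, Good φ e y κ z := by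
    filter_upwards [h3] with y hy
    have h5 : ∀ᵐ κ : ℝ, ∀ᵐ a : Eu d, y ≠ a → Good φ e y κ (a + κ • (y - a)) := by
      rwa [Measure.ae_ae_comm]
      refine MeasurableSet.imp ?_ (good_meas hφ e measurable_const (by fun_prop) (by fun_prop))
      exact (measurableSet_eq_fun measurable_const measurable_snd).compl
    have h6 : ∀ᵐ κ : ℝ, ∀ᵐ z : Eu d, Good φ e y κ z := by
      have n1 : ∀ᵐ κ : ℝ, κ ≠ 1 := by
        rw [ae_iff]; simp
      filter_upwards [h5, n1] with κ hκ hκ1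
      refine ae_affine volume (r := 1 - κ) (sub_ne_zero.2 hκ1.symm) (κ • y) ?_
      filter_upwards [hκ] with a ha
      by_cases hya : y = a
      · subst hya
        have : κ • y + (1 - κ) • y = y := by rw [← add_smul]; simp
        rw [this]
        intro hκ0 hκ2
        have p1 : 0 < 4 + ‖y‖ ^ 2 := by positivity
        have p2 : κ * (4 + ‖y‖ ^ 2) / (4 + ‖y‖ ^ 2) = κ := by field_simp
        rw [p2]
        have : κ < 1 := by nlinarith
        have := Real.rpow_le_one hκ0.le this.le he.le
        nlinarith [hφc y]
      · have := ha hya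
        have e2 : κ • y + (1 - κ) • a = a + κ • (y - a) := by
          rw [sub_smul, smul_sub, one_smul]; abel
        rwa [e2]
    rwa [Measure.ae_ae_comm]
    exact good_meas hφ e measurable_const (by fun_prop) (by fun_prop)
  have h5 : ∀ᵐ y : Eu d, ∀ᵐ z : Eu d, φ z ≤ φ y := by
    filter_upwards [h4] with y hy
    filter_upwards [hy] with z hz
    by_contra hlt
    push Not at hlt
    have hy0 : 0 < φ y := hc.trans_le (hφc y)
    have hz0 : 0 < φ z := hc.trans_le (hφc z)
    set R := (4 + ‖z‖ ^ 2) / (4 + ‖y‖ ^ 2) with hR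
    have hR0 : 0 < R := by positivity
    set q := (φ y / φ z) ^ (1 / e) with hq
    have hq0 : 0 < q := by positivity
    have hq1 : q < 1 := Real.rpow_lt_one (by positivity) ((div_lt_one hz0).2 hlt) (by positivity)
    have hsub : Set.Ioo (q * R) R ⊆ {κ | ¬ Good φ e y κ z} := by
      intro κ ⟨k1, k2⟩ hg
      have k0 : 0 < κ := lt_trans (by positivity) k1
      have k3 : κ * (4 + ‖y‖ ^ 2) < 4 + ‖z‖ ^ 2 := by
        rwa [hR, lt_div_iff₀ (by positivity)] at k2
      have k4 := hg k0 k3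
      have k5 : q < κ * (4 + ‖y‖ ^ 2) / (4 + ‖z‖ ^ 2) := by
        rw [lt_div_iff₀ (by positivity)]
        rw [hR, mul_div_assoc', div_lt_iff₀ (by positivity)] at k1
        exact k1
      have k6 := Real.rpow_lt_rpow hq0.le k5 he
      rw [hq, ← Real.rpow_mul (by positivity), one_div_mul_cancel he.ne', Real.rpow_one,
        div_lt_iff₀ hz0] at k6
      linarith
    rw [ae_iff] at hz
    have := measure_mono_null hsub hz
    rw [Real.volume_Ioo, ENNReal.ofReal_eq_zero] at this
    nlinarith
  have h6 : ∀ᵐ y : Eu d, ∀ᵐ z : Eu d, φ y ≤ φ z := by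
    rw [Measure.ae_ae_comm]
    · exact h5
    · exact measurableSet_le (hφ.comp measurable_fst) (hφ.comp measurable_snd)
  obtain ⟨y, hy1, hy2⟩ := (h5.and h6).exists
  refine ⟨φ y, ae_muY.2 ?_⟩
  filter_upwards [hy1, hy2] with z z1 z2 using le_antisymm z1 z2

end

section

open EuclideanGeometry (inversion)

lemma img_U (d : ℕ) : inversion (xo (d+1)) 2 '' upperHalf (d+1) = ball (zo (d+1)) 1 := by
  ext z
  constructor
  · rintro ⟨x, hx, rfl⟩
    have := aX_mem x
    rw [aX, if_pos hx] at this
    exact this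
  · intro hz
    rw [mem_ball] at hz
    have hzx : z ≠ xo (d+1) := by
      rintro rfl
      rw [dist_comm, dist_zo_xo] at hz
      exact lt_irrefl _ hz
    refine ⟨inversion (xo (d+1)) 2 z, ?_, EuclideanGeometry.inversion_inversion _ (by norm_num) _⟩
    have h0 : inversion (xo (d+1)) 2 z ≠ xo (d+1) := by
      rw [Ne, EuclideanGeometry.inversion_eq_center (by norm_num)]; exact hzx
    have h1 := inv_zo h0
    rw [EuclideanGeometry.inversion_inversion _ (by norm_num)] at h1
    have h2 := dist_pos.2 h0
    rw [mem_U]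
    have h3 : dist z (zo (d+1)) ^ 2 < 1 := by
      have := dist_nonneg (x := z) (y := zo (d+1)); nlinarith
    have h4 : 0 < dist (inversion (xo (d+1)) 2 z) (xo (d+1)) ^ 2 := by positivity
    nlinarith

lemma nuX_int (d : ℕ) {G : Eu (d+1) → ℝ≥0∞} (hG : Measurable G) :
    ∫⁻ z in ball (zo (d+1)) 1, G z = ∫⁻ x, G (aX d x) ∂nuX d := by
  rw [← img_U, inv_cov _ _ (by norm_num) U_meas (fun h => U_ne_xo h rfl), nuX, wM,
    lintegral_withDensity_eq_lintegral_mul _ (wX_meas.pow_const _).ennreal_ofReal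
      (show Measurable fun x => G (aX d x) from hG.comp aX_meas)]
  refine setLIntegral_congr_fun U_meas fun x hx => ?_
  simp only [Pi.mul_apply, aX, if_pos hx, Function.comp]
  rw [wX]; congr 4
  rw [div_pow]; norm_num

instance (d : ℕ) : IsFiniteMeasure (nuX d) := ⟨by
  have := nuX_int d (G := fun _ => 1) measurable_const
  simp only [lintegral_const, one_mul, Measure.restrict_apply_univ] at this
  rw [← this]; exact measure_ball_lt_top⟩

instance (d : ℕ) : NeZero (nuX d) := ⟨fun h => by
  have := nuX_int d (G := fun _ => 1) measurable_const
  simp only [lintegral_const, one_mul, Measure.restrict_apply_univ] at this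
  rw [h] at this
  simp at this
  exact (measure_ball_pos volume (zo (d+1)) one_pos).ne' this⟩

noncomputable def rst (d : ℕ) : Eu (d+1) →L[ℝ] Eu d :=
  LinearMap.toContinuousLinearMap
    { toFun := fun x => WithLp.toLp 2 (fun i => x i.castSucc)
      map_add' := fun x y => by ext i; simp
      map_smul' := fun c x => by ext i; simp }

lemma rst_apply {d : ℕ} (x : Eu (d+1)) (i : Fin d) : rst d x i = x i.castSucc := rfl

lemma rst_emd {d : ℕ} (y : Eu d) : rst d (emd d y) = y := by
  ext i; rw [rst_apply, emd_castSucc]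

lemma emd_rst {d : ℕ} {x : Eu (d+1)} (h : x (Fin.last d) = 0) : emd d (rst d x) = x :=
  emd_ext (fun i => by rw [emd_castSucc, rst_apply]) (by rw [emd_last, h])

/-- the cone map -/
noncomputable def Psi (d : ℕ) (x : Eu (d+1)) : Eu (d+1) :=
  x (Fin.last d) • (bY d (rst d x) - zo (d+1))

lemma Psi_norm {d : ℕ} {x : Eu (d+1)} (h : 0 < x (Fin.last d)) : ‖Psi d x‖ = x (Fin.last d) := by
  rw [Psi, norm_smul, ← dist_eq_norm, bY_mem, mul_one, Real.norm_of_nonneg h.le]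

lemma bY_inj {d : ℕ} {y z : Eu d} (h : bY d y = bY d z) : y = z :=
  emd_inj.1 (EuclideanGeometry.inversion_injective _ (by norm_num : (2:ℝ) ≠ 0) h)

lemma Psi_inj {d : ℕ} {x y : Eu (d+1)} (hx : 0 < x (Fin.last d)) (hy : 0 < y (Fin.last d))
    (h : Psi d x = Psi d y) : x = y := by
  have h1 : x (Fin.last d) = y (Fin.last d) := by rw [← Psi_norm hx, ← Psi_norm hy, h]
  have h2 : rst d x = rst d y := by
    rw [Psi, Psi, ← h1] at h
    exact bY_inj (sub_left_injective (smul_right_injective _ hx.ne' h))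
  refine emd_ext (fun i => ?_) h1
  rw [← rst_apply, ← rst_apply, h2]

/-- the linear part -/
noncomputable def Dg (d : ℕ) (k : ℝ) : Eu (d+1) →ₗ[ℝ] Eu (d+1) :=
  k • ((emL d).toLinearMap ∘ₗ (rst d : Eu (d+1) →ₗ[ℝ] Eu d)) +
    ((EuclideanSpace.proj (Fin.last d) : Eu (d+1) →L[ℝ] ℝ) : Eu (d+1) →ₗ[ℝ] ℝ).smulRight (zo (d+1))

lemma emL_apply {d : ℕ} (y : Eu d) : emL d y = emd d y := rfl

lemma Dg_apply {d : ℕ} (k : ℝ) (v : Eu (d+1)) :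
    Dg d k v = k • emd d (rst d v) + v (Fin.last d) • zo (d+1) := rfl

lemma Dg_det {d : ℕ} (k : ℝ) : LinearMap.det (Dg d k) = - k ^ d := by
  rw [← LinearMap.det_toMatrix (EuclideanSpace.basisFun (Fin (d+1)) ℝ).toBasis]
  have : LinearMap.toMatrix (EuclideanSpace.basisFun (Fin (d+1)) ℝ).toBasis
      (EuclideanSpace.basisFun (Fin (d+1)) ℝ).toBasis (Dg d k) =
      Matrix.diagonal (Fin.lastCases (motive := fun _ => ℝ) (-1) (fun _ => k)) := by
    ext i j
    rw [LinearMap.toMatrix_apply, Matrix.diagonal_apply]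
    simp only [OrthonormalBasis.coe_toBasis, EuclideanSpace.basisFun_apply,
      OrthonormalBasis.coe_toBasis_repr_apply, EuclideanSpace.basisFun_repr, Dg_apply]
    refine Fin.lastCases ?_ (fun i => ?_) i
    · simp [emd_last, zo_last, EuclideanSpace.single_apply, Pi.single_apply]
      split_ifs with h1
      · subst h1; simp [zo_last]
      · simp
    · simp [emd_castSucc, zo_castSucc, rst_apply, EuclideanSpace.single_apply, Pi.single_apply]
      split_ifs <;> simp [zo_castSucc]
  rw [this, Matrix.det_diagonal, Fin.prod_univ_castSucc]
  simp

lemma refl_zo {d : ℕ} (y : Eu d) :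
    ((Submodule.span ℝ {emd d y - xo (d+1)})ᗮ).reflection (zo (d+1)) = bY d y - zo (d+1) := by
  rw [Submodule.reflection_orthogonal_apply, Submodule.reflection_singleton_apply]
  have h1 : (inner ℝ (emd d y - xo (d+1)) (zo (d+1)) : ℝ) = -2 := by
    rw [PiLp.inner_apply, Fin.sum_univ_castSucc]
    simp [emd_castSucc, emd_last, xo_castSucc, xo_last, zo_castSucc, zo_last]
  have h2 : xo (d+1) = (2:ℝ) • zo (d+1) :=
    emd_ext (fun i => by simp [xo_castSucc, zo_castSucc]) (by simp [xo_last, zo_last])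
  rw [h1, bY, EuclideanGeometry.inversion, dist_eq_norm, div_pow, vsub_eq_sub, vadd_eq_add]
  simp only [RCLike.ofReal_real_eq_id, id]
  have h3 : ‖emd d y - xo (d+1)‖ ^ 2 ≠ 0 := by
    have := dist_pos.2 (emd_ne_xo y); rw [dist_eq_norm] at this; positivity
  have h4 : ((2:ℝ)^2 / ‖emd d y - xo (d+1)‖ ^ 2) = -(2 * (-2 / ‖emd d y - xo (d+1)‖ ^ 2)) := by ring
  rw [h4, ← Nat.cast_smul_eq_nsmul ℝ]
  generalize (-2 / ‖emd d y - xo (d+1)‖ ^ 2) = q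
  rw [h2]
  module

lemma Psi_deriv {d : ℕ} (x : Eu (d+1)) : ∃ D : Eu (d+1) →L[ℝ] Eu (d+1), HasFDerivAt (Psi d) D x ∧
    |D.det| = (wY d (rst d x) * |x (Fin.last d)|) ^ d := by
  have h1 := (EuclideanGeometry.hasFDerivAt_inversion (R := 2) (emd_ne_xo (rst d x)))
  have h2 : HasFDerivAt (fun x => emd d (rst d x)) ((emL d).toContinuousLinearMap.comp (rst d)) x :=
    ((emL d).toContinuousLinearMap.comp (rst d)).hasFDerivAt
  have h3 := (h1.comp x h2).sub_const (zo (d+1))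
  have h4 : HasFDerivAt (fun x : Eu (d+1) => x (Fin.last d)) (EuclideanSpace.proj (Fin.last d) : Eu (d+1) →L[ℝ] ℝ) x :=
    (EuclideanSpace.proj (Fin.last d) : Eu (d+1) →L[ℝ] ℝ).hasFDerivAt
  refine ⟨_, h4.smul h3, ?_⟩
  set R := ((Submodule.span ℝ {emd d (rst d x) - xo (d+1)})ᗮ).reflection with hR
  rw [ContinuousLinearMap.det]
  have key : ∀ E : Eu (d+1) →L[ℝ] Eu (d+1), (∀ v, E v = R (Dg d (wY d (rst d x) * x (Fin.last d)) v)) →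
      |LinearMap.det (E : Eu (d+1) →ₗ[ℝ] Eu (d+1))| = (wY d (rst d x) * |x (Fin.last d)|) ^ d := by
    intro E hE
    have : (E : Eu (d+1) →ₗ[ℝ] Eu (d+1)) = R.toLinearMap ∘ₗ (Dg d (wY d (rst d x) * x (Fin.last d))) :=
      LinearMap.ext hE
    rw [this, LinearMap.det_comp, Submodule.det_reflection, Dg_det, abs_mul, abs_pow (-1 : ℝ), abs_neg, abs_one, one_pow, one_mul,
      abs_neg, abs_pow, abs_mul, abs_of_pos (wY_pos _)]
  refine key _ fun v => ?_
  rw [Dg_apply, map_add, map_smul, map_smul, hR, refl_zo, ← hR]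
  have hw : (2 / dist (emd d (rst d x)) (xo (d+1))) ^ 2 = wY d (rst d x) := by
    rw [wY, wX, div_pow]; norm_num
  simp only [ContinuousLinearMap.add_apply, ContinuousLinearMap.smul_apply, ContinuousLinearMap.smulRight_apply,
    ContinuousLinearMap.comp_apply, hw, Function.comp]
  rw [mul_comm (wY d _), mul_smul]
  rfl

lemma split_mp (d : ℕ) : MeasurePreserving (fun x : Eu (d+1) => (x (Fin.last d), rst d x)) volume
    ((volume : Measure ℝ).prod volume) := by
  have h1 := PiLp.volume_preserving_ofLp (Fin (d+1))
  have h2 := volume_preserving_piFinSuccAbove (fun _ : Fin (d+1) => ℝ) (Fin.last d)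
  have h3 := (MeasurePreserving.id (volume : Measure ℝ)).prod (PiLp.volume_preserving_toLp (Fin d))
  have := h3.comp (h2.comp h1)
  have e : (fun x : Eu (d+1) => (x (Fin.last d), rst d x)) = Prod.map id (WithLp.toLp 2) ∘
      ⇑(MeasurableEquiv.piFinSuccAbove (fun x => ℝ) (Fin.last d)) ∘ WithLp.ofLp := by
    funext x
    refine Prod.ext rfl ?_
    ext i
    simp [rst_apply, MeasurableEquiv.piFinSuccAbove, Fin.removeNth]
    rfl
  rw [e]
  exact this

lemma int_Ioo (d : ℕ) : ∫⁻ r in Set.Ioo (0:ℝ) 1, ENNReal.ofReal (r ^ d) = ((d+1 : ℕ) : ℝ≥0∞)⁻¹ := by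
  rw [← ofReal_integral_eq_lintegral_ofReal]
  · rw [← integral_Ioc_eq_integral_Ioo, ← intervalIntegral.integral_of_le zero_le_one, integral_pow]
    simp only [one_pow, zero_pow (Nat.succ_ne_zero d), sub_zero]
    rw [one_div, ENNReal.ofReal_inv_of_pos (by positivity)]
    congr 1
    rw [← ENNReal.ofReal_natCast]; simp
  · exact ((continuous_pow d).integrableOn_Icc).mono_set Set.Ioo_subset_Icc_self
  · filter_upwards [ae_restrict_mem measurableSet_Ioo] with r hr
    exact pow_nonneg hr.1.le _

/-- preimage of the cone -/
def DS (d : ℕ) (S : Set (Eu (d+1))) : Set (Eu (d+1)) :=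
  {x | x (Fin.last d) ∈ Set.Ioo (0:ℝ) 1 ∧ bY d (rst d x) ∈ S}

lemma DS_meas {d : ℕ} {S : Set (Eu (d+1))} (hS : MeasurableSet S) : MeasurableSet (DS d S) :=
  ((by fun_prop : Measurable fun x : Eu (d+1) => x (Fin.last d)) measurableSet_Ioo).inter
    ((bY_meas.comp (rst d).continuous.measurable) hS)

lemma vol_DS {d : ℕ} {S : Set (Eu (d+1))} (hS : MeasurableSet S) :
    volume (Psi d '' DS d S) = ((d+1 : ℕ) : ℝ≥0∞)⁻¹ * (muY d) (bY d ⁻¹' S) := by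
  choose D hD hD' using Psi_deriv (d := d)
  rw [← lintegral_abs_det_fderiv_eq_addHaar_image volume (DS_meas hS)
    (fun x _ => (hD x).hasFDerivWithinAt) (fun x hx y hy h => Psi_inj hx.1.1 hy.1.1 h)]
  have hT : MeasurableSet (bY d ⁻¹' S) := bY_meas hS
  have hw : Measurable fun y => ENNReal.ofReal (wY d y ^ d) := (wY_meas.pow_const _).ennreal_ofReal
  have h1 : muY d (bY d ⁻¹' S) = ∫⁻ y in bY d ⁻¹' S, ENNReal.ofReal (wY d y ^ d) := by
    rw [muY, wM, withDensity_apply _ hT, Measure.restrict_restrict hT, Set.inter_univ]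
  have h2 := ((split_mp d).restrict_preimage ((measurableSet_Ioo (a := (0:ℝ)) (b := 1)).prod hT)).lintegral_comp
      (f := fun z : ℝ × Eu d => ENNReal.ofReal (z.1 ^ d) * ENNReal.ofReal (wY d z.2 ^ d))
      ((by fun_prop : Measurable fun z : ℝ × Eu d => ENNReal.ofReal (z.1 ^ d)).mul (hw.comp measurable_snd))
  rw [h1, ← int_Ioo, ← lintegral_prod_mul (by fun_prop) hw.aemeasurable, Measure.prod_restrict,
    ← h2]
  refine setLIntegral_congr_fun (DS_meas hS) fun x hx => ?_
  beta_reduce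
  rw [hD', mul_pow, abs_of_pos hx.1.1, mul_comm, ENNReal.ofReal_mul (pow_nonneg hx.1.1.le _)]

open Pointwise in
lemma cone_ae {d : ℕ} (hd : 0 < d) (S : Set (Eu (d+1))) :
    volume (Set.Ioo (0:ℝ) 1 • (Subtype.val '' {p : sphere (0 : Eu (d+1)) 1 | zo (d+1) + (p : Eu (d+1)) ∈ S})) =
      volume (Psi d '' DS d S) := by
  set N : Submodule ℝ (Eu (d+1)) := Submodule.span ℝ {xo (d+1) - zo (d+1)} with hN
  have hN0 : volume (N : Set (Eu (d+1))) = 0 := by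
    refine Measure.addHaar_submodule _ _ fun h => ?_
    have h1 := finrank_span_le_card (R := ℝ) ({xo (d+1) - zo (d+1)} : Set (Eu (d+1)))
    rw [← hN, h] at h1
    simp at h1
    omega
  refine le_antisymm ?_ (measure_mono ?_)
  · refine (measure_mono (t := Psi d '' DS d S ∪ N) ?_).trans ((measure_union_le _ _).trans (by rw [hN0, add_zero]))
    rintro _ ⟨r, hr, _, ⟨p, hp, rfl⟩, rfl⟩
    have hp1 : ‖(p : Eu (d+1))‖ = 1 := by simpa using p.2
    by_cases hx : zo (d+1) + (p : Eu (d+1)) = xo (d+1)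
    · right
      have : (p : Eu (d+1)) = xo (d+1) - zo (d+1) := by rw [← hx]; abel
      simp only [this]
      exact N.smul_mem _ (Submodule.mem_span_singleton_self _)
    · left
      set z := inversion (xo (d+1)) 2 (zo (d+1) + (p : Eu (d+1))) with hz
      have h0 : z ≠ xo (d+1) := by
        rw [Ne, EuclideanGeometry.inversion_eq_center (by norm_num)]; exact hx
      have h1 := inv_zo h0
      rw [hz, EuclideanGeometry.inversion_inversion _ (by norm_num), ← hz] at h1
      have h2 : dist (zo (d+1) + (p : Eu (d+1))) (zo (d+1)) = 1 := by
        rw [dist_eq_norm, add_sub_cancel_left, hp1]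
      have h3 : z (Fin.last d) = 0 := by rw [h2] at h1; linarith
      have h4 : bY d (rst d z) = zo (d+1) + (p : Eu (d+1)) := by
        rw [bY, emd_rst h3, hz, EuclideanGeometry.inversion_inversion _ (by norm_num)]
      set x : Eu (d+1) := emd d (rst d z) - r • zo (d+1) with hxx
      have h5 : x (Fin.last d) = r := by simp [hxx, emd_last, zo_last]
      have h6 : rst d x = rst d z := by ext i; simp [hxx, rst_apply, emd_castSucc, zo_castSucc]
      refine ⟨x, ⟨by rw [h5]; exact hr, by rw [h6, h4]; exact hp⟩, ?_⟩
      rw [Psi, h5, h6, h4, add_sub_cancel_left]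
  · rintro _ ⟨x, hx, rfl⟩
    refine ⟨x (Fin.last d), hx.1, _, ⟨⟨bY d (rst d x) - zo (d+1), ?_⟩, ?_, rfl⟩, rfl⟩
    · rw [mem_sphere, dist_zero_right, ← dist_eq_norm, bY_mem]
    · show zo (d+1) + (bY d (rst d x) - zo (d+1)) ∈ S
      rw [add_sub_cancel]; exact hx.2

lemma muY_map {d : ℕ} (hd : 0 < d) : Measure.map (bY d) (muY d) = surf (d+1) := by
  refine Measure.ext fun S hS => ?_
  have hm : Measurable fun p : sphere (0 : Eu (d+1)) 1 => zo (d+1) + (p : Eu (d+1)) := by fun_prop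
  rw [Measure.map_apply bY_meas hS, surf, Measure.map_apply hm hS, Measure.toSphere_apply' _ (hm hS)]
  have := cone_ae hd S
  rw [vol_DS hS] at this
  have h2 : ((fun p : sphere (0 : Eu (d+1)) 1 => zo (d+1) + (p : Eu (d+1))) ⁻¹' S) = {p : sphere (0 : Eu (d+1)) 1 | zo (d+1) + (p : Eu (d+1)) ∈ S} := rfl
  rw [h2, this, ← mul_assoc, finrank_euclideanSpace_fin, ENNReal.mul_inv_cancel (by simp) (by simp), one_mul]

lemma muY_univ {d : ℕ} (hd : 0 < d) : muY d Set.univ = ((d+1 : ℕ) : ℝ≥0∞) * volume (ball (0 : Eu (d+1)) 1) := by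
  have h := congrArg (fun m => m Set.univ) (muY_map hd)
  have hm : Measurable fun p : sphere (0 : Eu (d+1)) 1 => zo (d+1) + (p : Eu (d+1)) := by fun_prop
  simp only [Measure.map_apply bY_meas MeasurableSet.univ, surf, Measure.map_apply hm MeasurableSet.univ,
    Set.preimage_univ] at h
  rw [h, Measure.toSphere_apply_univ, finrank_euclideanSpace_fin]

lemma muY_fin {d : ℕ} (hd : 0 < d) : IsFiniteMeasure (muY d) := ⟨by
  rw [muY_univ hd]; exact ENNReal.mul_lt_top (by simp) measure_ball_lt_top⟩

lemma muY_ne {d : ℕ} (hd : 0 < d) : NeZero (muY d) := ⟨fun h => by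
  have h1 := muY_univ hd
  rw [h] at h1
  simp at h1
  exact (measure_ball_pos volume (0 : Eu (d+1)) one_pos).ne' h1⟩

end

section

open EuclideanGeometry (inversion)

lemma KK_pos {d : ℕ} {l : ℝ} (x : Eu (d+1)) (y : Eu d) : 0 < KK d l x y := by
  refine Real.rpow_pos_of_pos (norm_pos_iff.2 (sub_ne_zero.2 fun h => ?_)) _
  have h1 := aX_mem x
  rw [h, bY_mem] at h1
  exact lt_irrefl _ h1

/-- the potential of the constant -/
noncomputable def E1 (d : ℕ) (l : ℝ) (x : Eu (d+1)) : ℝ := ∫ y, KK d l x y ∂(muY d)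

lemma KK_slice {d : ℕ} {l : ℝ} (hl : 0 < l) (x : Eu (d+1)) : BddM fun y => KK d l x y := by
  refine ⟨?_, 2 ^ (2 * l), fun y => ?_⟩
  · unfold KK
    exact ((measurable_const.sub bY_meas).norm).pow_const _
  · rw [abs_of_nonneg (KK_nonneg _ _)]
    exact KK_le hl _ _

section
variable {d : ℕ} {l : ℝ} [IsFiniteMeasure (muY d)]

lemma E1_pos [NeZero (muY d)] (hl : 0 < l) (x : Eu (d+1)) : 0 < E1 d l x := by
  rw [E1, integral_pos_iff_support_of_nonneg (fun y => KK_nonneg x y) (KK_slice hl x).integrable]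
  have : Function.support (fun y => KK d l x y) = Set.univ := by
    ext y; simp [(KK_pos x y).ne']
  rw [this]
  exact Measure.measure_univ_pos.2 (NeZero.ne _)

lemma E1_bddM (hl : 0 < l) : BddM (E1 d l) := by
  refine ⟨?_, 2 ^ (2 * l) * (muY d).real Set.univ, fun x => ?_⟩
  · exact ((KK_bddM hl).1.stronglyMeasurable.integral_prod_right).measurable
  · have := norm_integral_le_of_norm_le_const (μ := muY d) (f := fun y => KK d l x y) (C := 2 ^ (2 * l))
      (ae_of_all _ fun y => by rw [Real.norm_of_nonneg (KK_nonneg x y)]; exact KK_le hl x y)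
    exact this

lemma JJ_one (hl : 0 < l) {ψ : Eu (d+1) → ℝ} (hψ : BddM ψ) :
    JJ (muY d) (nuX d) (KK d l) 1 ψ = ∫ x, ψ x * E1 d l x ∂(nuX d) := by
  rw [JJ, integral_prod _ (JJ_bdd (KK_bddM hl) (φ := 1) (BddM.const 1) hψ).integrable]
  refine integral_congr_ae (ae_of_all _ fun x => ?_)
  simp only [Pi.one_apply, mul_one, integral_const_mul, E1]

lemma rev_holder [NeZero (muY d)] (hl : 0 < l) {c C t : ℝ} (hc : 0 < c) (ht : t = (d+1) / (d+1+l))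
    (hI : Integrable (fun x => E1 d l x ^ (-(d+1)/l)) (nuX d))
    (hA : 0 < ∫ x, E1 d l x ^ (-(d+1)/l) ∂(nuX d)) {ψ : Eu (d+1) → ℝ} (hψ : Band c C ψ) :
    (∫ x, E1 d l x ^ (-(d+1)/l) ∂(nuX d)) ^ (-l / (d+1)) * (∫ x, ψ x ^ t ∂(nuX d)) ^ (1 / t) ≤
      JJ (muY d) (nuX d) (KK d l) 1 ψ := by
  have hd : (0:ℝ) < d + 1 := by positivity
  have ht0 : 0 < t := by rw [ht]; positivity
  have ht1 : 1 - t = l / (d+1+l) := by rw [ht]; field_simp; ring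
  have ht2 : 0 < 1 - t := by rw [ht1]; positivity
  have hψ0 : ∀ x, 0 < ψ x := fun x => hc.trans_le (hψ.2 x).1
  have hE := fun x => E1_pos (d := d) hl x
  have hEb := E1_bddM (d := d) hl
  have hb := hψ.bddM.mul hEb
  rw [JJ_one hl hψ.bddM]
  set A := ∫ x, E1 d l x ^ (-(d+1)/l) ∂(nuX d) with hAdef
  have hconj : (1/t).HolderConjugate (1/(1-t)) := by
    rw [Real.holderConjugate_iff]
    refine ⟨by rw [lt_div_iff₀ ht0]; linarith, by simp⟩
  have hf : MemLp (fun x => (ψ x * E1 d l x) ^ t) (ENNReal.ofReal (1/t)) (nuX d) := by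
    obtain ⟨M, hM⟩ := hb.2
    refine MemLp.of_bound (hb.1.pow_const t).aestronglyMeasurable (M ^ t) (ae_of_all _ fun x => ?_)
    have h1 := mul_pos (hψ0 x) (hE x)
    rw [Real.norm_of_nonneg (Real.rpow_nonneg h1.le _)]
    exact Real.rpow_le_rpow h1.le ((le_abs_self _).trans (hM x)) ht0.le
  have hpw : ∀ x, (E1 d l x ^ (-t)) ^ (1/(1-t)) = E1 d l x ^ (-(d+1)/l) := fun x => by
    rw [← Real.rpow_mul (hE x).le]; congr 1; rw [ht1, ht]; field_simp
  have hg : MemLp (fun x => E1 d l x ^ (-t)) (ENNReal.ofReal (1/(1-t))) (nuX d) := by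
    rw [← integrable_norm_rpow_iff (hEb.1.pow_const _).aestronglyMeasurable (by simpa using ht2) (by simp),
      ENNReal.toReal_ofReal (by positivity)]
    refine hI.congr (ae_of_all _ fun x => ?_)
    beta_reduce
    rw [Real.norm_of_nonneg (Real.rpow_nonneg (hE x).le _), hpw]
  have key := integral_mul_le_Lp_mul_Lq_of_nonneg hconj
    (ae_of_all _ fun x => Real.rpow_nonneg (mul_pos (hψ0 x) (hE x)).le t)
    (ae_of_all _ fun x => Real.rpow_nonneg (hE x).le _) hf hg
  simp only [hpw, ← hAdef] at key
  have e1 : ∀ x, (ψ x * E1 d l x) ^ t * E1 d l x ^ (-t) = ψ x ^ t := fun x => by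
    rw [Real.mul_rpow (hψ0 x).le (hE x).le, mul_assoc, ← Real.rpow_add (hE x)]; simp
  have e2 : ∀ x, ((ψ x * E1 d l x) ^ t) ^ (1/t) = ψ x * E1 d l x := fun x => by
    rw [← Real.rpow_mul (mul_pos (hψ0 x) (hE x)).le, mul_one_div_cancel ht0.ne', Real.rpow_one]
  simp only [e1, e2, one_div_one_div] at key
  have hB : 0 ≤ ∫ x, ψ x * E1 d l x ∂(nuX d) := integral_nonneg fun x => (mul_pos (hψ0 x) (hE x)).le
  have key2 := Real.rpow_le_rpow (integral_nonneg fun x => Real.rpow_nonneg (hψ0 x).le t) key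
    (show 0 ≤ 1 / t by positivity)
  rw [Real.mul_rpow (Real.rpow_nonneg hB _) (Real.rpow_nonneg hA.le _), ← Real.rpow_mul hB,
    mul_one_div_cancel ht0.ne', Real.rpow_one, ← Real.rpow_mul hA.le] at key2
  have e3 : (1 - t) * (1 / t) = - (-l / (d+1)) := by rw [ht1, ht]; field_simp
  rw [e3, Real.rpow_neg hA.le] at key2
  have hp := Real.rpow_pos_of_pos hA (-l / (d+1))
  calc _ ≤ A ^ (-l / (d+1)) * ((∫ x, ψ x * E1 d l x ∂(nuX d)) * (A ^ (-l / (d+1)))⁻¹) :=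
        mul_le_mul_of_nonneg_left key2 hp.le
    _ = _ := by field_simp

end

lemma nuX_map (d : ℕ) : Measure.map (aX d) (nuX d) = volume.restrict (ball (zo (d+1)) 1) := by
  refine Measure.ext fun S hS => ?_
  have := nuX_int d (G := S.indicator 1) (measurable_one.indicator hS)
  rw [lintegral_indicator_one hS] at this
  rw [Measure.map_apply aX_meas hS, this, ← lintegral_indicator_one (aX_meas hS)]
  rfl

lemma Ce1_eq {d : ℕ} (hd : 0 < d) {l : ℝ} :
    Ce1 (d+1) (d+1+2*l) = ((muY d).real Set.univ) ^ (-((d+l)/d)) *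
      (∫ x, E1 d l x ^ (-(d+1)/l) ∂(nuX d)) ^ (-l / (d+1)) := by
  have hs : IsFiniteMeasure (surf (d+1)) := by unfold surf; infer_instance
  have hd' : (0:ℝ) < d := by exact_mod_cast hd
  rw [Ce1, ← nuX_map, integral_map aX_meas.aemeasurable]
  · congr 1
    · congr 1
      · rw [measureReal_def, muY_univ hd, ENNReal.toReal_mul, unitBallVol, ENNReal.toReal_natCast]
      · push_cast; rw [add_sub_cancel_right, neg_inj, div_eq_div_iff (by positivity) hd'.ne']; ring
    · have : ∀ x, ∫ ζ, ‖aX d x - ζ‖ ^ (d + 1 + 2 * l - ((d+1 : ℕ) : ℝ)) ∂surf (d+1) = E1 d l x := by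
        intro x
        rw [← muY_map hd, integral_map bY_meas.aemeasurable, E1]
        · simp only [KK]; congr 1; funext y; congr 1; push_cast; ring
        · exact Measurable.aestronglyMeasurable (by fun_prop)
      simp only [this]
      congr 1
      · congr 1; funext x; congr 1; push_cast
        by_cases h : l = 0
        · simp [h]
        · field_simp; ring
      · push_cast; field_simp; ring
  · refine Measurable.aestronglyMeasurable (Measurable.pow_const (StronglyMeasurable.measurable ?_) _)
    refine StronglyMeasurable.integral_prod_right (f := fun z ζ : Eu (d+1) => ‖z - ζ‖ ^ (d + 1 + 2 * l - ((d+1 : ℕ) : ℝ))) ?_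
    exact Measurable.stronglyMeasurable (by fun_prop)

theorem HLS_band {d : ℕ} (hd : 0 < d) {l c C p t : ℝ} (hl : 0 < l) (hc : 0 < c) (hcC : c ≤ C)
    (hp : p = d / (d + l)) (ht : t = (d+1) / (d+1+l)) {φ : Eu d → ℝ} {ψ : Eu (d+1) → ℝ}
    (hφ : Band c C φ) (hψ : Band c C ψ) :
    Ce1 (d+1) (d+1+2*l) * (∫ y, φ y ^ p ∂(muY d)) ^ (1 / p) * (∫ x, ψ x ^ t ∂(nuX d)) ^ (1 / t) ≤
      JJ (muY d) (nuX d) (KK d l) φ ψ := by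
  have := muY_fin hd
  have := muY_ne hd
  have hd' : (0:ℝ) < d := by exact_mod_cast hd
  have hμ : 0 < (muY d).real Set.univ := measureReal_univ_pos
  have hp0 : 0 < p := by rw [hp]; positivity
  have ht0 : 0 < t := by rw [ht]; positivity
  have hE := fun x => E1_pos (d := d) hl x
  have hJ0 : 0 ≤ JJ (muY d) (nuX d) (KK d l) φ ψ := integral_nonneg fun z =>
    mul_nonneg (mul_nonneg (hc.le.trans (hψ.2 _).1) (hc.le.trans (hφ.2 _).1)) (KK_nonneg _ _)
  rcases (integral_nonneg fun x => Real.rpow_nonneg (hE x).le (-(d+1)/l) :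
      0 ≤ ∫ x, E1 d l x ^ (-(d+1)/l) ∂(nuX d)).eq_or_lt with hA | hA
  · rw [Ce1_eq hd, ← hA, Real.zero_rpow (by apply ne_of_lt; rw [neg_div, neg_lt_zero]; positivity)]
    simpa using hJ0
  have hI : Integrable (fun x => E1 d l x ^ (-(d+1)/l)) (nuX d) := by
    by_contra h
    rw [integral_undef h] at hA
    exact lt_irrefl _ hA
  refine abs_opt (muY d) (nuX d) (KK_ufr hl) (KK_bddM hl) KK_nonneg ?_ hc hcC hp0 ?_ ht0 ?_ ?_ ?_ ?_ φ ψ hφ hψ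
  · rw [JJ_one hl (ψ := 1) (BddM.const 1)]
    simp only [Pi.one_apply, one_mul]
    rw [integral_pos_iff_support_of_nonneg (fun y => (hE y).le) (E1_bddM hl).integrable]
    have : Function.support (E1 d l) = Set.univ := by
      ext y; simp [(hE y).ne']
    rw [this]
    exact Measure.measure_univ_pos.2 (NeZero.ne _)
  · rw [hp, div_lt_one (by positivity)]; linarith
  · rw [ht, div_lt_one (by positivity)]; linarith
  · intro φ ψ hφ hψ
    by_cases h : ∃ φ' ψ', Band c C φ' ∧ Band c C ψ' ∧ ∫ y, φ' y ^ p ∂(muY d) = ∫ y, φ y ^ p ∂(muY d) ∧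
        ∫ x, ψ' x ^ t ∂(nuX d) = ∫ x, ψ x ^ t ∂(nuX d) ∧
        JJ (muY d) (nuX d) (KK d l) φ' ψ' ≤ JJ (muY d) (nuX d) (KK d l) φ ψ ∧
        ∫ y, φ y ^ (p / 2) ∂(muY d) < ∫ y, φ' y ^ (p / 2) ∂(muY d)
    · exact Or.inr h
    · left
      refine ae_const (e := d + l) (by positivity) hc hφ.1 (fun y => (hφ.2 y).1) fun a ρ θ hρ hθ hθ0 => ?_
      refine (pol_step a hd hρ hθ hθ0 hc hl ?_ ?_ hφ hψ).resolve_right h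
      · rw [hp]; field_simp
      · rw [ht]; push_cast; field_simp
  · rw [Ce1_eq hd]; positivity
  · intro ψ hψ
    have := rev_holder hl hc ht hI hA hψ
    rw [Ce1_eq hd]
    refine le_trans (le_of_eq ?_) this
    have h1 : (muY d).real Set.univ ^ (-((d + l) / d)) * (muY d).real Set.univ ^ (1 / p) = 1 := by
      rw [← Real.rpow_add hμ, hp, one_div_div]; simp
    calc _ = ((muY d).real Set.univ ^ (-((d + l) / d)) * (muY d).real Set.univ ^ (1 / p)) *
          ((∫ x, E1 d l x ^ (-(d+1)/l) ∂(nuX d)) ^ (-l / (d+1)) * (∫ x, ψ x ^ t ∂(nuX d)) ^ (1 / t)) := by ring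
      _ = _ := by rw [h1, one_mul]

end

section

open EuclideanGeometry (inversion)

lemma lint_band {Y : Type} [MeasurableSpace Y] {μ : Measure Y} [IsFiniteMeasure μ] {c C p : ℝ} (hc : 0 < c)
    (hp : 0 < p) {φ : Y → ℝ} (hφ : Band c C φ) :
    (∫⁻ y, ENNReal.ofReal (φ y) ^ p ∂μ) ^ (1 / p) = ENNReal.ofReal ((∫ y, φ y ^ p ∂μ) ^ (1 / p)) := by
  have h0 : ∀ y, 0 < φ y := fun y => hc.trans_le (hφ.2 y).1
  rw [← ENNReal.ofReal_rpow_of_nonneg (integral_nonneg fun y => Real.rpow_nonneg (h0 y).le _) (by positivity),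
    ofReal_integral_eq_lintegral_ofReal (hφ.rpow hc).integrable (ae_of_all _ fun y => Real.rpow_nonneg (h0 y).le _)]
  congr 1
  refine lintegral_congr fun y => ?_
  rw [ENNReal.ofReal_rpow_of_pos (h0 y)]

theorem HLS_bandE {d : ℕ} (hd : 0 < d) {l c C p t : ℝ} (hl : 0 < l) (hc : 0 < c) (hcC : c ≤ C)
    (hp : p = d / (d + l)) (ht : t = (d+1) / (d+1+l)) {φ : Eu d → ℝ} {ψ : Eu (d+1) → ℝ}
    (hφ : Band c C φ) (hψ : Band c C ψ) :
    ENNReal.ofReal (Ce1 (d+1) (d+1+2*l)) * (∫⁻ y, ENNReal.ofReal (φ y) ^ p ∂(muY d)) ^ (1 / p) *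
        (∫⁻ x, ENNReal.ofReal (ψ x) ^ t ∂(nuX d)) ^ (1 / t) ≤
      ∫⁻ z, ENNReal.ofReal (ψ z.1 * φ z.2 * KK d l z.1 z.2) ∂((nuX d).prod (muY d)) := by
  have := muY_fin hd
  have hd' : (0:ℝ) < d := by exact_mod_cast hd
  have hp0 : 0 < p := by rw [hp]; positivity
  have ht0 : 0 < t := by rw [ht]; positivity
  have hφ0 : ∀ y, 0 < φ y := fun y => hc.trans_le (hφ.2 y).1
  have hψ0 : ∀ y, 0 < ψ y := fun y => hc.trans_le (hψ.2 y).1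
  rw [lint_band hc hp0 hφ, lint_band hc ht0 hψ,
    ← ENNReal.ofReal_mul' (Real.rpow_nonneg (integral_nonneg fun y => Real.rpow_nonneg (hφ0 y).le _) _),
    ← ENNReal.ofReal_mul' (Real.rpow_nonneg (integral_nonneg fun y => Real.rpow_nonneg (hψ0 y).le _) _),
    ← ofReal_integral_eq_lintegral_ofReal (JJ_bdd (KK_bddM hl) hφ.bddM hψ.bddM).integrable
      (ae_of_all _ fun z => mul_nonneg (mul_nonneg (hψ0 _).le (hφ0 _).le) (KK_nonneg _ _))]
  exact ENNReal.ofReal_le_ofReal (HLS_band hd hl hc hcC hp ht hφ hψ)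

open Filter Topology in
theorem HLS_trunc {d : ℕ} (hd : 0 < d) {l p t k : ℝ} (hl : 0 < l) (hk : 0 ≤ k)
    (hp : p = d / (d + l)) (ht : t = (d+1) / (d+1+l)) {F : Eu d → ℝ} {G : Eu (d+1) → ℝ}
    (hF : Measurable F) (hG : Measurable G) (hF0 : ∀ y, 0 ≤ F y) (hG0 : ∀ x, 0 ≤ G x)
    (hFk : ∀ y, F y ≤ k) (hGk : ∀ x, G x ≤ k) :
    ENNReal.ofReal (Ce1 (d+1) (d+1+2*l)) * (∫⁻ y, ENNReal.ofReal (F y) ^ p ∂(muY d)) ^ (1 / p) *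
        (∫⁻ x, ENNReal.ofReal (G x) ^ t ∂(nuX d)) ^ (1 / t) ≤
      ∫⁻ z, ENNReal.ofReal (G z.1 * F z.2 * KK d l z.1 z.2) ∂((nuX d).prod (muY d)) := by
  have := muY_fin hd
  have hd' : (0:ℝ) < d := by exact_mod_cast hd
  have hp0 : 0 < p := by rw [hp]; positivity
  have ht0 : 0 < t := by rw [ht]; positivity
  set R := ∫⁻ z, ENNReal.ofReal (G z.1 * F z.2 * KK d l z.1 z.2) ∂((nuX d).prod (muY d)) with hR
  set T := ((nuX d).prod (muY d)) Set.univ with hT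
  have hTf : T ≠ ⊤ := measure_ne_top _ _
  have key : ∀ m : ℕ, ENNReal.ofReal (Ce1 (d+1) (d+1+2*l)) * (∫⁻ y, ENNReal.ofReal (F y) ^ p ∂(muY d)) ^ (1 / p) *
        (∫⁻ x, ENNReal.ofReal (G x) ^ t ∂(nuX d)) ^ (1 / t) ≤
        R + ENNReal.ofReal (1 / ((m:ℝ) + 1) * ((2 * k + 1) * 2 ^ (2 * l))) * T := by
    intro m
    set δ : ℝ := 1 / ((m:ℝ) + 1) with hδ
    have hδ0 : 0 < δ := by positivity
    have hδ1 : δ ≤ 1 := by rw [hδ, div_le_one (by positivity)]; linarith [(Nat.cast_nonneg m : (0:ℝ) ≤ m)]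
    have hb := HLS_bandE hd hl hδ0 (C := k + δ) (by linarith) hp ht (φ := fun y => F y + δ) (ψ := fun x => G x + δ)
      ⟨hF.add_const _, fun y => ⟨by linarith [hF0 y], by linarith [hFk y]⟩⟩
      ⟨hG.add_const _, fun y => ⟨by linarith [hG0 y], by linarith [hGk y]⟩⟩
    refine le_trans ?_ (hb.trans ?_)
    · gcongr
      · linarith
      · linarith
    · rw [hT, ← lintegral_const, hR, ← lintegral_add_right _ measurable_const]
      refine lintegral_mono fun z => ?_
      rw [← ENNReal.ofReal_add (mul_nonneg (mul_nonneg (hG0 _) (hF0 _)) (KK_nonneg _ _)) (by positivity)]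
      refine ENNReal.ofReal_le_ofReal ?_
      have h1 : (G z.1 + δ) * (F z.2 + δ) ≤ G z.1 * F z.2 + δ * (2 * k + 1) := by
        nlinarith [hGk z.1, hFk z.2, hG0 z.1, hF0 z.2]
      have h2 := KK_le hl z.1 z.2
      have h3 := KK_nonneg (l := l) z.1 z.2
      have h4 : 0 ≤ δ * (2 * k + 1) := by positivity
      calc _ ≤ (G z.1 * F z.2 + δ * (2 * k + 1)) * KK d l z.1 z.2 := mul_le_mul_of_nonneg_right h1 h3
        _ ≤ _ := by rw [add_mul, ← mul_assoc]; gcongr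
  have e0 : R = R + ENNReal.ofReal (0 * ((2 * k + 1) * 2 ^ (2 * l))) * T := by simp
  rw [e0]
  refine ge_of_tendsto' (x := atTop) ?_ key
  refine tendsto_const_nhds.add (ENNReal.Tendsto.mul_const ?_ (Or.inr hTf))
  refine ENNReal.tendsto_ofReal ?_
  exact (tendsto_one_div_add_atTop_nhds_zero_nat).mul_const _

open Filter Topology in
lemma trunc_tendsto {Y : Type} [MeasurableSpace Y] (μ : Measure Y) {p : ℝ} (hp : 0 < p) {F : Y → ℝ}
    (hF : Measurable F) : Tendsto (fun k : ℕ => (∫⁻ y, ENNReal.ofReal (min (F y) k) ^ p ∂μ) ^ (1 / p)) atTop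
      (𝓝 ((∫⁻ y, ENNReal.ofReal (F y) ^ p ∂μ) ^ (1 / p))) := by
  refine (ENNReal.continuous_rpow_const.tendsto _).comp ?_
  refine lintegral_tendsto_of_tendsto_of_monotone (fun k => ?_) (ae_of_all _ fun y i j hij => ?_) (ae_of_all _ fun y => ?_)
  · exact (((hF.min measurable_const).ennreal_ofReal).pow_const _).aemeasurable
  · have : (i:ℝ) ≤ j := by exact_mod_cast hij
    beta_reduce
    gcongr
  · obtain ⟨N, hN⟩ := exists_nat_ge (F y)
    refine tendsto_const_nhds.congr' ?_
    filter_upwards [eventually_ge_atTop N] with k hk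
    rw [min_eq_left (hN.trans (by exact_mod_cast hk))]

open Filter Topology in
theorem HLS_gen {d : ℕ} (hd : 0 < d) {l p t : ℝ} (hl : 0 < l)
    (hp : p = d / (d + l)) (ht : t = (d+1) / (d+1+l)) {F : Eu d → ℝ} {G : Eu (d+1) → ℝ}
    (hF : Measurable F) (hG : Measurable G) (hF0 : ∀ y, 0 ≤ F y) (hG0 : ∀ x, 0 ≤ G x)
    (hFf : (∫⁻ y, ENNReal.ofReal (F y) ^ p ∂(muY d)) ^ (1 / p) ≠ ⊤)
    (hGf : (∫⁻ x, ENNReal.ofReal (G x) ^ t ∂(nuX d)) ^ (1 / t) ≠ ⊤) :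
    ENNReal.ofReal (Ce1 (d+1) (d+1+2*l)) * (∫⁻ y, ENNReal.ofReal (F y) ^ p ∂(muY d)) ^ (1 / p) *
        (∫⁻ x, ENNReal.ofReal (G x) ^ t ∂(nuX d)) ^ (1 / t) ≤
      ∫⁻ z, ENNReal.ofReal (G z.1 * F z.2 * KK d l z.1 z.2) ∂((nuX d).prod (muY d)) := by
  have hd' : (0:ℝ) < d := by exact_mod_cast hd
  have hp0 : 0 < p := by rw [hp]; positivity
  have ht0 : 0 < t := by rw [ht]; positivity
  refine le_of_tendsto' (x := atTop) (ENNReal.Tendsto.mul (ENNReal.Tendsto.const_mul (trunc_tendsto (muY d) hp0 hF)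
    (Or.inr ENNReal.ofReal_ne_top)) (Or.inr hGf) (trunc_tendsto (nuX d) ht0 hG)
    (Or.inr (ENNReal.mul_ne_top ENNReal.ofReal_ne_top hFf))) fun k => ?_
  refine (HLS_trunc hd hl (k := k) (Nat.cast_nonneg k) hp ht (hF.min measurable_const) (hG.min measurable_const)
    (fun y => le_min (hF0 y) (Nat.cast_nonneg k)) (fun y => le_min (hG0 y) (Nat.cast_nonneg k))
    (fun y => min_le_right _ _) (fun y => min_le_right _ _)).trans (lintegral_mono fun z => ENNReal.ofReal_le_ofReal ?_)
  refine mul_le_mul_of_nonneg_right ?_ (KK_nonneg _ _)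
  exact mul_le_mul (min_le_left _ _) (min_le_left _ _) (le_min (hF0 _) (Nat.cast_nonneg k)) (hG0 _)

/-- pointwise identity for the norms -/
lemma pw_norm {w f e p : ℝ} {N : ℕ} (hw : 0 < w) (hf : 0 ≤ f) (hp : 0 < p) (hpe : e * p = N) :
    ENNReal.ofReal (w ^ N) * ENNReal.ofReal (f / w ^ e) ^ p = ENNReal.ofReal f ^ p := by
  rw [ENNReal.ofReal_rpow_of_nonneg (by positivity) hp.le, ENNReal.ofReal_rpow_of_nonneg hf hp.le,
    ← ENNReal.ofReal_mul (by positivity), Real.div_rpow hf (by positivity), ← Real.rpow_mul hw.le, hpe, Real.rpow_natCast]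
  congr 1
  have : w ^ N ≠ 0 := by positivity
  field_simp

theorem HLS_fin {d : ℕ} (hd : 0 < d) {l p t : ℝ} (hl : 0 < l)
    (hp : p = d / (d + l)) (ht : t = (d+1) / (d+1+l)) {f : Eu d → ℝ} {g : Eu (d+1) → ℝ}
    (hf : Measurable f) (hg : Measurable g) (hf0 : ∀ y, 0 ≤ f y) (hg0 : ∀ x, 0 ≤ g x)
    (hFf : eLp volume f p ≠ ⊤) (hGf : eLp (volume.restrict (upperHalf (d+1))) g t ≠ ⊤) :
    ENNReal.ofReal (Ce1 (d+1) (d+1+2*l)) * eLp volume f p * eLp (volume.restrict (upperHalf (d+1))) g t ≤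
      ∫⁻ x in upperHalf (d+1), ∫⁻ y, ENNReal.ofReal (g x) * ENNReal.ofReal (f y) *
        ENNReal.ofReal (‖x - emd d y‖ ^ (2 * l)) := by
  have := muY_fin hd
  have hd' : (0:ℝ) < d := by exact_mod_cast hd
  have hp0 : 0 < p := by rw [hp]; positivity
  have ht0 : 0 < t := by rw [ht]; positivity
  set F : Eu d → ℝ := fun y => f y / wY d y ^ (d + l) with hF
  set G : Eu (d+1) → ℝ := fun x => g x / wX d x ^ (d + 1 + l) with hG
  have hwX0 : ∀ x, 0 ≤ wX d x := fun x => by unfold wX; positivity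
  have hFm : Measurable F := hf.div (wY_meas.pow_const _)
  have hGm : Measurable G := hg.div (wX_meas.pow_const _)
  have hF0 : ∀ y, 0 ≤ F y := fun y => div_nonneg (hf0 y) (Real.rpow_nonneg (wY_pos y).le _)
  have hG0 : ∀ y, 0 ≤ G y := fun y => div_nonneg (hg0 y) (Real.rpow_nonneg (hwX0 y) _)
  have hwYm : Measurable fun y => ENNReal.ofReal (wY d y ^ d) := (wY_meas.pow_const _).ennreal_ofReal
  have hwXm : Measurable fun y => ENNReal.ofReal (wX d y ^ (d+1)) := (wX_meas.pow_const _).ennreal_ofReal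
  have e1 : (∫⁻ y, ENNReal.ofReal (F y) ^ p ∂(muY d)) ^ (1 / p) = eLp volume f p := by
    rw [eLp, muY, wM, lintegral_withDensity_eq_lintegral_mul _ hwYm (hFm.ennreal_ofReal.pow_const _),
      Measure.restrict_univ]
    congr 1
    refine lintegral_congr fun y => ?_
    exact pw_norm (wY_pos y) (hf0 y) hp0 (by rw [hp]; field_simp)
  have e2 : (∫⁻ y, ENNReal.ofReal (G y) ^ t ∂(nuX d)) ^ (1 / t) = eLp (volume.restrict (upperHalf (d+1))) g t := by
    rw [eLp, nuX, wM, lintegral_withDensity_eq_lintegral_mul _ hwXm (hGm.ennreal_ofReal.pow_const _)]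
    congr 1
    refine setLIntegral_congr_fun U_meas fun y hy => ?_
    exact pw_norm (wX_pos (U_ne_xo hy)) (hg0 y) ht0 (by rw [ht]; push_cast; field_simp)
  have h := HLS_gen hd hl hp ht hFm hGm hF0 hG0 (by rw [e1]; exact hFf) (by rw [e2]; exact hGf)
  rw [e1, e2] at h
  refine h.trans (le_of_eq ?_)
  have hK := (KK_bddM (d := d) hl).1
  have hm : Measurable fun z : Eu (d+1) × Eu d => ENNReal.ofReal (G z.1 * F z.2 * KK d l z.1 z.2) :=
    (((hGm.comp measurable_fst).mul (hFm.comp measurable_snd)).mul hK).ennreal_ofReal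
  rw [lintegral_prod _ hm.aemeasurable, nuX, wM,
    lintegral_withDensity_eq_lintegral_mul _ hwXm hm.lintegral_prod_right']
  refine setLIntegral_congr_fun U_meas fun x hx => ?_
  simp only [Pi.mul_apply]
  have hm2 : Measurable fun y => ENNReal.ofReal (G x * F y * KK d l x y) := hm.comp measurable_prodMk_left
  rw [muY, wM, lintegral_withDensity_eq_lintegral_mul _ hwYm hm2,
    Measure.restrict_univ, ← lintegral_const_mul _ (hwYm.mul hm2)]
  refine lintegral_congr fun y => ?_
  have hx0 := wX_pos (U_ne_xo hx)
  have hy0 := wY_pos y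
  simp only [Pi.mul_apply, Function.comp]
  rw [← ENNReal.ofReal_mul (by positivity), ← ENNReal.ofReal_mul (by positivity), ← ENNReal.ofReal_mul (hg0 x),
    ← ENNReal.ofReal_mul (mul_nonneg (hg0 x) (hf0 y)), KK_eq hx, hF, hG]
  congr 1
  beta_reduce
  rw [Real.mul_rpow (by positivity) (by positivity), Real.mul_rpow hx0.le hy0.le, ← Real.rpow_natCast_mul dist_nonneg,
    dist_eq_norm, Real.rpow_add hy0, Real.rpow_add hx0, Real.rpow_natCast]
  have e3 : wX d x ^ ((d:ℝ) + 1) = wX d x ^ (d+1) := by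
    rw [← Real.rpow_natCast]; push_cast; rfl
  rw [e3]
  push_cast
  have a1 := Real.rpow_pos_of_pos hx0 l
  have a2 := Real.rpow_pos_of_pos hy0 l
  field_simp


end

/-- Theorem 1.1, reversed sharp HLS on the upper half space. -/
theorem reversed_HLS_upper_half_space
    (n : ℕ) (hn : 2 ≤ n) (α : ℝ) (hα : (n : ℝ) < α) (p t : ℝ)
    (hp : p = 2 * ((n : ℝ) - 1) / ((n : ℝ) + α - 2))
    (ht : t = 2 * (n : ℝ) / ((n : ℝ) + α))
    (f : Eu (n - 1) → ℝ) (hf0 : ∀ y, 0 ≤ f y) (hfm : Measurable f)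
    (hfp : eLp (volume : Measure (Eu (n - 1))) f p ≠ ⊤)
    (g : Eu n → ℝ) (hg0 : ∀ x, 0 ≤ g x) (hgm : Measurable g)
    (hgt : eLp ((volume : Measure (Eu n)).restrict (upperHalf n)) g t ≠ ⊤) :
    ENNReal.ofReal (Ce1 n α) * eLp (volume : Measure (Eu (n - 1))) f p *
        eLp ((volume : Measure (Eu n)).restrict (upperHalf n)) g t ≤
      ∫⁻ x in upperHalf n, ∫⁻ y,
          ENNReal.ofReal (g x) * ENNReal.ofReal (f y) *
            ENNReal.ofReal (‖x - emb n y‖ ^ (α - (n : ℝ)))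
        ∂(volume : Measure (Eu (n - 1))) ∂(volume : Measure (Eu n)) := by
  obtain ⟨d, rfl⟩ : ∃ d, n = d + 1 := ⟨n - 1, by omega⟩
  have hd : 0 < d := by omega
  have hd' : (0:ℝ) < d := by exact_mod_cast hd
  obtain ⟨l, rfl⟩ : ∃ l, α = d + 1 + 2 * l := ⟨(α - (d+1)) / 2, by ring⟩
  push_cast at hα hp ht
  have hl : 0 < l := by linarith
  have e : (d:ℝ) + 1 + 2 * l - ((d+1 : ℕ) : ℝ) = 2 * l := by push_cast; ring
  rw [e]
  refine HLS_fin (f := f) hd hl ?_ ?_ hfm hgm hf0 hg0 hfp hgt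
  · rw [hp, div_eq_div_iff (by linarith) (by positivity)]; ring
  · rw [ht, div_eq_div_iff (by linarith) (by positivity)]; ring
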